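/- arXiv:1403.3042 — 2 statements merged into one kernel-verified Lean document; each statement's English description precedes it below -/
import Mathlib

section
/- Let M be a κ-combinatorial model category (κ a regular cardinal). Suppose that: (i) there is a set A of κ-presentable cofibrant objects such that every object of M is a κ-filtered colimit of objects in A; (ii) every κ-presentable cofibrant object in A has a (not necessarily functorial) cylinder object which is again κ-presentable; (iii) whenever a composite morphism i′ = q ∘ i is a cofibration between cofibrant objects, the morphism i is a formal cofibration. Then the full subcategory W of the arrow category M^→ spanned by the weak equivalences is κ-accessible; that is, W is closed under κ-filtered colimits in M^→ and every weak equivalence is a κ-filtered colimit in M^→ of weak equivalences between κ-presentable objects. -/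
open CategoryTheory CategoryTheory.Limits

universe w v u

namespace PaperAcc

/-- A category `J` is `κ`-filtered if every diagram indexed by a category with fewer than `κ`
arrows admits a cocone. -/
def IsCardinalFiltered (J : Type v) [Category.{v} J] (κ : Cardinal.{v}) : Prop :=
  ∀ (A : Type v) [SmallCategory A], Cardinal.mk (Arrow A) < κ →
    ∀ F : A ⥤ J, Nonempty (Cocone F)

/-- A preorder `P` is `κ`-directed if every subset of cardinality `< κ` has an upper bound. -/
def IsCardinalDirected (P : Type v) [Preorder P] (κ : Cardinal.{v}) : Prop :=
  ∀ S : Set P, Cardinal.mk S < κ → ∃ p : P, ∀ s ∈ S, s ≤ p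

/-- An object `X` is `κ`-presentable if `Hom(X, -)` preserves `κ`-filtered colimits. -/
def IsPresentable {M : Type u} [Category.{v} M] (κ : Cardinal.{v}) (X : M) : Prop :=
  ∀ (J : Type v) [SmallCategory J], IsCardinalFiltered J κ →
    Nonempty (PreservesColimitsOfShape J (coyoneda.obj (Opposite.op X)))

/-- A presentation of `X` as a `κ`-filtered colimit of objects belonging to `P`. -/
structure FilteredColimitPresentation {M : Type u} [Category.{v} M] (κ : Cardinal.{v})
    (P : Set M) (X : M) where
  J : Type v
  [instJ : SmallCategory J]
  filtered : IsCardinalFiltered J κ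
  F : J ⥤ M
  mem : ∀ j, F.obj j ∈ P
  c : Cocone F
  isColimit : IsColimit c
  iso : c.pt ≅ X

/-- A presentation of `X` as a `κ`-directed colimit of objects belonging to `P`. -/
structure DirectedColimitPresentation {M : Type u} [Category.{v} M] (κ : Cardinal.{v})
    (P : Set M) (X : M) where
  J : Type v
  [instJ : Preorder J]
  directed : IsCardinalDirected J κ
  F : J ⥤ M
  mem : ∀ j, F.obj j ∈ P
  c : Cocone F
  isColimit : IsColimit c
  iso : c.pt ≅ X

/-- A class of arrows (viewed as a full subcategory of the arrow category) is closed under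
`κ`-filtered colimits. -/
def ClosedUnderFilteredColimits {M : Type u} [Category.{v} M] (κ : Cardinal.{v})
    (P : Set (Arrow M)) : Prop :=
  ∀ (J : Type v) [SmallCategory J], IsCardinalFiltered J κ →
    ∀ (F : J ⥤ Arrow M) (c : Cocone F), IsColimit c → (∀ j, F.obj j ∈ P) → c.pt ∈ P

/-- The morphisms having the right lifting property with respect to every member of the
family `f`. -/
def RlpOf {M : Type u} [Category.{v} M] {ι : Type w} {A B : ι → M}
    (f : ∀ i, A i ⟶ B i) : MorphismProperty M :=
  fun _ _ g => ∀ i, HasLiftingProperty (f i) g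

/-- The morphisms having the left lifting property with respect to every morphism in `P`. -/
def Llp {M : Type u} [Category.{v} M] (P : MorphismProperty M) : MorphismProperty M :=
  fun _ _ g => ∀ ⦃X Y : M⦄ (p : X ⟶ Y), P p → HasLiftingProperty g p

/-- The class `C` is cofibrantly generated by a set of morphisms between `κ`-presentable
objects: `C = llp(rlp(I))` for such a set `I`. -/
def CofibrantlyGeneratedByPresentables {M : Type u} [Category.{v} M] (κ : Cardinal.{v})
    (C : MorphismProperty M) : Prop :=
  ∃ (ι : Type v) (A B : ι → M) (f : ∀ i, A i ⟶ B i),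
    (∀ i, IsPresentable κ (A i)) ∧ (∀ i, IsPresentable κ (B i)) ∧
      C = Llp (RlpOf f)

/-- A category is locally `κ`-presentable: it is cocomplete and has a set of `κ`-presentable
objects such that every object is a `κ`-filtered colimit of objects from this set. -/
def IsLocallyPresentable (M : Type u) [Category.{v} M] (κ : Cardinal.{v}) : Prop :=
  HasColimits M ∧
    ∃ (ι : Type v) (G : ι → M), (∀ i, IsPresentable κ (G i)) ∧
      ∀ X : M, Nonempty (FilteredColimitPresentation κ (Set.range G) X)

/-- A class of morphisms is stable under retracts (in the arrow category). -/
def IsStableUnderRetracts {M : Type u} [Category.{v} M] (P : MorphismProperty M) : Prop :=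
  ∀ {X Y X' Y' : M} (f : X ⟶ Y) (g : X' ⟶ Y') (iX : X ⟶ X') (rX : X' ⟶ X)
    (iY : Y ⟶ Y') (rY : Y' ⟶ Y), iX ≫ rX = 𝟙 X → iY ≫ rY = 𝟙 Y →
    iX ≫ g = f ≫ iY → rX ≫ f = g ≫ rY → P g → P f

/-- A model structure on a category: classes of weak equivalences, cofibrations and fibrations
satisfying the axioms of a (closed) model category. -/
structure ModelStructure (M : Type u) [Category.{v} M] where
  W : MorphismProperty M
  Cof : MorphismProperty M
  Fib : MorphismProperty M
  W_id : ∀ X : M, W (𝟙 X)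
  W_comp : ∀ {X Y Z : M} (f : X ⟶ Y) (g : Y ⟶ Z), W f → W g → W (f ≫ g)
  W_of_comp_right : ∀ {X Y Z : M} (f : X ⟶ Y) (g : Y ⟶ Z), W g → W (f ≫ g) → W f
  W_of_comp_left : ∀ {X Y Z : M} (f : X ⟶ Y) (g : Y ⟶ Z), W f → W (f ≫ g) → W g
  W_retract : IsStableUnderRetracts W
  Cof_retract : IsStableUnderRetracts Cof
  Fib_retract : IsStableUnderRetracts Fib
  lift_trivCof_fib : ∀ {A B X Y : M} (i : A ⟶ B) (p : X ⟶ Y),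
    Cof i → W i → Fib p → HasLiftingProperty i p
  lift_cof_trivFib : ∀ {A B X Y : M} (i : A ⟶ B) (p : X ⟶ Y),
    Cof i → Fib p → W p → HasLiftingProperty i p
  fact_cof_trivFib : ∀ {X Y : M} (f : X ⟶ Y),
    ∃ (Z : M) (i : X ⟶ Z) (p : Z ⟶ Y), Cof i ∧ Fib p ∧ W p ∧ i ≫ p = f
  fact_trivCof_fib : ∀ {X Y : M} (f : X ⟶ Y),
    ∃ (Z : M) (i : X ⟶ Z) (p : Z ⟶ Y), Cof i ∧ W i ∧ Fib p ∧ i ≫ p = f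

/-- A model structure is `κ`-combinatorial if the underlying category is locally
`κ`-presentable and both cofibrations and trivial cofibrations are cofibrantly generated
by sets of morphisms between `κ`-presentable objects. -/
structure IsCombinatorial {M : Type u} [Category.{v} M] (S : ModelStructure M)
    (κ : Cardinal.{v}) : Prop where
  isRegular : κ.IsRegular
  locallyPresentable : IsLocallyPresentable M κ
  cofGenerated : CofibrantlyGeneratedByPresentables κ S.Cof
  trivCofGenerated : CofibrantlyGeneratedByPresentables κ (S.Cof ⊓ S.W)

/-- An object is cofibrant if the morphism from an(y) initial object to it is a cofibration. -/
def Cofibrant {M : Type u} [Category.{v} M] (S : ModelStructure M) (X : M) : Prop :=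
  ∀ ⦃O : M⦄, IsInitial O → ∀ f : O ⟶ X, S.Cof f

/-- A cylinder object for `X`: a factorization `X ⊔ X → C → X` of the codiagonal into
a cofibration followed by a weak equivalence. -/
structure CylinderObject {M : Type u} [Category.{v} M] (S : ModelStructure M) (X : M) where
  C : M
  i₀ : X ⟶ C
  i₁ : X ⟶ C
  p : C ⟶ X
  hi₀ : i₀ ≫ p = 𝟙 X
  hi₁ : i₁ ≫ p = 𝟙 X
  hp : S.W p
  hcof : ∀ (c : BinaryCofan X X) (hc : IsColimit c), S.Cof (hc.desc (BinaryCofan.mk i₀ i₁))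

/-- A commutative square on `(f, g, h, k)` (with `f : A ⟶ B`, `g : A ⟶ X`, `h : B ⟶ Y`,
`k : X ⟶ Y`) is a homotopy pushout: for some (equivalently, any) replacement of the span
`B ← A → X` by a span of cofibrations between cofibrant objects which is weakly equivalent
to it, the comparison morphism from the (strict) pushout of the replacement to `Y` is a
weak equivalence. -/
def IsHomotopyPushout {M : Type u} [Category.{v} M] (S : ModelStructure M)
    {A B X Y : M} (f : A ⟶ B) (g : A ⟶ X) (h : B ⟶ Y) (k : X ⟶ Y) : Prop :=
  ∃ (A' B' X' P : M) (wA : A' ⟶ A) (i : A' ⟶ B') (wB : B' ⟶ B)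
    (j : A' ⟶ X') (wX : X' ⟶ X) (pB : B' ⟶ P) (pX : X' ⟶ P) (m : P ⟶ Y),
      Cofibrant S A' ∧ S.W wA ∧ S.Cof i ∧ S.W wB ∧ S.Cof j ∧ S.W wX ∧
      i ≫ wB = wA ≫ f ∧ j ≫ wX = wA ≫ g ∧
      IsPushout i j pB pX ∧ pB ≫ m = wB ≫ h ∧ pX ≫ m = wX ≫ k ∧ S.W m

/-- A morphism `i : A ⟶ B` is a formal cofibration if every pushout square of `i` along a
morphism `f : A ⟶ X` with `X` cofibrant is a homotopy pushout. -/
def IsFormalCofibration {M : Type u} [Category.{v} M] (S : ModelStructure M)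
    {A B : M} (i : A ⟶ B) : Prop :=
  ∀ {X Y : M} (f : A ⟶ X) (g : B ⟶ Y) (k : X ⟶ Y),
    Cofibrant S X → IsPushout i f g k → IsHomotopyPushout S i f g k

/-- The set of arrows satisfying `P` whose domain and codomain are `κ`-presentable. -/
def PresentableArrowsIn {M : Type u} [Category.{v} M] (κ : Cardinal.{v})
    (P : Set (Arrow M)) : Set (Arrow M) :=
  {a | a ∈ P ∧ IsPresentable κ a.left ∧ IsPresentable κ a.right}

end PaperAcc

namespace PaperAccAux

section Attach

variable {M : Type u} [Category.{v} M] [HasColimits M]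
  {Φ : Type v} [Preorder Φ] {Q : Type v}

/-- The functor sending `φ` to the coproduct of the objects `D q` with `stage q ≤ φ`. -/
noncomputable def stageSum (stage : Q → Φ) (D : Q → M) : Φ ⥤ M where
  obj φ := ∐ (fun q : {q : Q // stage q ≤ φ} => D q.1)
  map {φ ψ} h := Sigma.desc (fun q =>
    Sigma.ι (fun q : {q : Q // stage q ≤ ψ} => D q.1) ⟨q.1, q.2.trans (leOfHom h)⟩)

variable (stage : Q → Φ) {D E : Q → M}

/-- The inclusion of a summand in `stageSum`. -/
noncomputable def stageι (D : Q → M) (φ : Φ) (q : Q) (hq : stage q ≤ φ) :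
    D q ⟶ (stageSum stage D).obj φ :=
  Sigma.ι (fun q : {q : Q // stage q ≤ φ} => D q.1) ⟨q, hq⟩

@[simp]
lemma stageι_map {φ ψ : Φ} (h : φ ⟶ ψ) (q : Q) (hq : stage q ≤ φ) :
    stageι stage D φ q hq ≫ (stageSum stage D).map h =
      stageι stage D ψ q (hq.trans (leOfHom h)) := by
  simp [stageι, stageSum]

lemma stageSum_hom_ext {φ : Φ} {X : M} {a b : (stageSum stage D).obj φ ⟶ X}
    (h : ∀ q hq, stageι stage D φ q hq ≫ a = stageι stage D φ q hq ≫ b) : a = b :=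
  Sigma.hom_ext _ _ (fun q => h q.1 q.2)

/-- The map on sums induced by a family of maps. -/
noncomputable def stageSumMap (g : ∀ q, D q ⟶ E q) :
    stageSum stage D ⟶ stageSum stage E where
  app φ := Limits.Sigma.map (fun q => g q.1)
  naturality φ ψ h := by
    apply stageSum_hom_ext
    intro q hq
    simp [stageSum, stageι]

@[simp]
lemma stageι_stageSumMap (g : ∀ q, D q ⟶ E q) (φ : Φ) (q : Q) (hq : stage q ≤ φ) :
    stageι stage D φ q hq ≫ (stageSumMap stage g).app φ = g q ≫ stageι stage E φ q hq := by
  exact Limits.Sigma.ι_map (f := fun q : {q : Q // stage q ≤ φ} => D q.1)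
    (g := fun q : {q : Q // stage q ≤ φ} => E q.1) (fun q => g q.1) ⟨q, hq⟩

/-- A transformation out of a sum is determined by maps `D q ⟶ F.obj (stage q)`. -/
noncomputable def stageSumDesc (F : Φ ⥤ M) (u : ∀ q, D q ⟶ F.obj (stage q)) :
    stageSum stage D ⟶ F where
  app φ := Sigma.desc (fun q => u q.1 ≫ F.map (homOfLE q.2))
  naturality φ ψ h := by
    apply stageSum_hom_ext
    intro q hq
    simp only [stageSum, stageι, colimit.ι_desc_assoc, Cofan.mk_ι_app, Category.assoc,
      colimit.ι_desc, ← Functor.map_comp]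
    rfl

@[simp]
lemma stageι_stageSumDesc (F : Φ ⥤ M) (u : ∀ q, D q ⟶ F.obj (stage q))
    (φ : Φ) (q : Q) (hq : stage q ≤ φ) :
    stageι stage D φ q hq ≫ (stageSumDesc stage F u).app φ = u q ≫ F.map (homOfLE hq) := by
  exact Limits.Sigma.ι_desc (f := fun q : {q : Q // stage q ≤ φ} => D q.1) _ _

lemma stageSum_isCardinalPresentable (κ : Cardinal.{v}) [Fact κ.IsRegular]
    (hD : ∀ q, IsCardinalPresentable (D q) κ) (φ : Φ)
    (h : HasCardinalLT {q : Q // stage q ≤ φ} κ) :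
    IsCardinalPresentable ((stageSum stage D).obj φ) κ := by
  have := hD
  have (k : Discrete {q : Q // stage q ≤ φ}) : IsCardinalPresentable
      ((Discrete.functor (fun q : {q : Q // stage q ≤ φ} => D q.1)).obj k) κ := hD _
  exact isCardinalPresentable_of_isColimit _ (coproductIsCoproduct
    (fun q : {q : Q // stage q ≤ φ} => D q.1)) κ (by simpa using h)

end Attach

lemma isCardinalPresentable_of_isPushout {M : Type u} [Category.{v} M] {A B C P : M}
    {f : A ⟶ B} {g : A ⟶ C} {l : B ⟶ P} {r : C ⟶ P} (h : IsPushout f g l r)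
    (κ : Cardinal.{v}) [Fact κ.IsRegular] (hA : IsCardinalPresentable A κ)
    (hB : IsCardinalPresentable B κ) (hC : IsCardinalPresentable C κ) :
    IsCardinalPresentable P κ := by
  have (k : WalkingSpan) : IsCardinalPresentable ((span f g).obj k) κ := by
    rcases k with (_ | _ | _) <;> assumption
  exact isCardinalPresentable_of_isColimit _ h.isColimit κ
    (hasCardinalLT_of_finite _ _ (Cardinal.IsRegular.aleph0_le Fact.out))

section Succ

variable {M : Type u} [Category.{v} M] [HasColimits M]
  {Φ : Type v} [Preorder Φ] {Q : Type v} {ι : Type v} {D E : ι → M} (g : ∀ i, D i ⟶ E i)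
  {Z : M}

/-- A lifting problem of a member of the family `g` against the structure map of `F` at some
stage. -/
structure Problem (F : Over ((Functor.const Φ).obj Z)) where
  φ : Φ
  i : ι
  u : D i ⟶ F.left.obj φ
  v : E i ⟶ Z
  w : u ≫ F.hom.app φ = g i ≫ v

variable {g} (F : Over ((Functor.const Φ).obj Z)) (stage : Problem g F → Φ)
  (hstage : ∀ q, q.φ ≤ stage q)

/-- The attaching maps of all lifting problems. -/
noncomputable def attachDom : stageSum stage (fun q => D q.i) ⟶ F.left :=
  stageSumDesc stage F.left (fun q => q.u ≫ F.left.map (homOfLE (hstage q)))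

/-- The cells of all lifting problems. -/
noncomputable def attachCells :
    stageSum stage (fun q => D q.i) ⟶ stageSum stage (fun q => E q.i) :=
  stageSumMap stage (fun q => g q.i)

/-- The structure map of the cells. -/
noncomputable def attachCod :
    stageSum stage (fun q => E q.i) ⟶ (Functor.const Φ).obj Z :=
  stageSumDesc stage ((Functor.const Φ).obj Z) (fun q => q.v)

lemma attach_comm : attachDom F stage hstage ≫ F.hom =
    attachCells F stage ≫ attachCod F stage := by
  ext φ
  apply stageSum_hom_ext
  intro q hq
  have h1 := stageι_stageSumDesc stage F.left
    (fun q => q.u ≫ F.left.map (homOfLE (hstage q))) φ q hq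
  have h2 := stageι_stageSumMap stage (fun q => g q.i) φ q hq
  have h3 := stageι_stageSumDesc stage ((Functor.const Φ).obj Z) (fun q => q.v) φ q hq
  have h4 := F.hom.naturality (homOfLE ((hstage q).trans hq))
  have h5 := q.w
  dsimp [attachDom, attachCells, attachCod] at *
  rw [reassoc_of% h1, reassoc_of% h2, h3, ← F.left.map_comp_assoc]
  simp only [Category.comp_id] at h4 ⊢
  rw [← h5, ← h4]
  rfl

/-- The result of attaching cells for all lifting problems, the cell of `q` being attached
at `stage q`. -/
noncomputable def attach : Over ((Functor.const Φ).obj Z) :=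
  Over.mk (pushout.desc F.hom (attachCod F stage) (attach_comm F stage hstage))

/-- The inclusion in `attach`. -/
noncomputable def toAttach : F ⟶ attach F stage hstage :=
  Over.homMk (pushout.inl _ _)
    (pushout.inl_desc F.hom (attachCod F stage) (attach_comm F stage hstage))

/-- The inclusion of the cells in `attach`. -/
noncomputable def attachInr :
    stageSum stage (fun q => E q.i) ⟶ (attach F stage hstage).left :=
  pushout.inr (attachDom F stage hstage) (attachCells F stage)

lemma attachInr_hom : attachInr F stage hstage ≫ (attach F stage hstage).hom =
    attachCod F stage :=
  pushout.inr_desc F.hom (attachCod F stage) (attach_comm F stage hstage)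

lemma attach_isPushout (φ : Φ) :
    IsPushout ((attachDom F stage hstage).app φ) ((attachCells F stage).app φ)
      ((toAttach F stage hstage).left.app φ)
      ((attachInr F stage hstage).app φ) :=
  (IsPushout.of_hasPushout (attachDom F stage hstage) (attachCells F stage)).map
    ((evaluation Φ M).obj φ)

lemma toAttach_mem (φ : Φ) :
    (MorphismProperty.ofHoms g).rlp.llp ((toAttach F stage hstage).left.app φ) := by
  refine MorphismProperty.of_isPushout (attach_isPushout F stage hstage φ) ?_
  refine MorphismProperty.colimMap _ ?_
  rintro ⟨q⟩
  exact MorphismProperty.le_llp_rlp _ _ (MorphismProperty.ofHoms.mk q.1.i)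

lemma attach_isCardinalPresentable (κ : Cardinal.{v}) [Fact κ.IsRegular]
    (hD : ∀ i, IsCardinalPresentable (D i) κ) (hE : ∀ i, IsCardinalPresentable (E i) κ) (φ : Φ)
    (h : HasCardinalLT {q // stage q ≤ φ} κ) (hF : IsCardinalPresentable (F.left.obj φ) κ) :
    IsCardinalPresentable ((attach F stage hstage).left.obj φ) κ := by
  have h1 := stageSum_isCardinalPresentable stage κ (D := fun q => D q.i) (fun q => hD _) φ h
  have h2 := stageSum_isCardinalPresentable stage κ (D := fun q => E q.i) (fun q => hE _) φ h
  exact isCardinalPresentable_of_isPushout (attach_isPushout F stage hstage φ) κ h1 hF h2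

lemma attach_solves (q : Problem g F) :
    ∃ l : E q.i ⟶ (attach F stage hstage).left.obj (stage q),
      g q.i ≫ l = q.u ≫ F.left.map (homOfLE (hstage q)) ≫
        (toAttach F stage hstage).left.app (stage q) ∧
      l ≫ (attach F stage hstage).hom.app (stage q) = q.v := by
  refine ⟨stageι stage (fun q => E q.i) (stage q) q le_rfl ≫
    (attachInr F stage hstage).app (stage q), ?_, ?_⟩
  · have h1 := stageι_stageSumDesc stage F.left
      (fun q => q.u ≫ F.left.map (homOfLE (hstage q))) _ q le_rfl
    have h2 := stageι_stageSumMap stage (fun q => g q.i) _ q le_rfl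
    have h3 := (attach_isPushout F stage hstage (stage q)).w
    have h4 : (fun q : Problem g F => g q.i) q ≫ stageι stage (fun q => E q.i) (stage q) q le_rfl ≫
        (attachInr F stage hstage).app (stage q) =
        stageι stage (fun q => D q.i) (stage q) q le_rfl ≫ (attachCells F stage).app (stage q) ≫
        (attachInr F stage hstage).app (stage q) := by
      simp only [← Category.assoc]
      exact congrArg (· ≫ _) h2.symm
    refine h4.trans ?_
    rw [← h3, ← Category.assoc, attachDom, h1]
    simp
  · have h3 := stageι_stageSumDesc stage ((Functor.const Φ).obj Z) (fun q => q.v) _ q le_rfl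
    have h4 := NatTrans.congr_app (attachInr_hom F stage hstage) (stage q)
    rw [NatTrans.comp_app] at h4
    rw [Category.assoc]
    exact (congrArg (_ ≫ ·) h4).trans (h3.trans (Category.comp_id _))

end Succ

lemma hasCardinalLT_arrow_preorder {P : Type v} [Preorder P] {κ : Cardinal.{v}}
    [Fact κ.IsRegular] (h : HasCardinalLT P κ) : HasCardinalLT (Arrow P) κ :=
  (hasCardinalLT_prod (Cardinal.IsRegular.aleph0_le Fact.out) h h).of_injective
    (fun a => (a.left, a.right)) (fun a b hab => by
      simp only [Prod.mk.injEq] at hab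
      obtain ⟨h1, h2⟩ := hab
      exact Arrow.ext h1 h2 (Subsingleton.elim _ _))

section Tower

variable {M : Type u} [Category.{v} M] [HasColimits M]
  {Φ : Type v} [Preorder Φ] {ι : Type v} {D E : ι → M} (g : ∀ i, D i ⟶ E i)
  {Z : M} {Ω : Type v} [Nonempty Ω]

open Classical in
/-- A labelling of the lifting problems, injective as soon as there is an injective one. -/
noncomputable def label (F : Over ((Functor.const Φ).obj Z)) : Problem g F → Ω :=
  if h : ∃ l : Problem g F → Ω, Function.Injective l then h.choose
  else fun _ => Classical.arbitrary Ω

lemma label_injective {F : Over ((Functor.const Φ).obj Z)}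
    (h : ∃ l : Problem g F → Ω, Function.Injective l) :
    Function.Injective (label (Ω := Ω) g F) := by
  rw [label, dif_pos h]
  exact h.choose_spec

variable (bump : Φ → Ω → Φ)

/-- The successor structure attaching cells for all lifting problems, at stages determined by
their labels. -/
noncomputable def towerStruct (hbump : ∀ φ ω, φ ≤ bump φ ω)
    (X₀ : Over ((Functor.const Φ).obj Z)) :
    SmallObject.SuccStruct (Over ((Functor.const Φ).obj Z)) where
  X₀ := X₀
  succ F := attach (g := g) F (fun q => bump q.φ (label g F q)) (fun _ => hbump _ _)
  toSucc F := toAttach (g := g) F (fun q => bump q.φ (label g F q)) (fun _ => hbump _ _)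

lemma label_stage_hasCardinalLT {κ : Cardinal.{v}}
    (hsmall : ∀ ψ, HasCardinalLT {ω : Ω // ∃ φ, bump φ ω ≤ ψ} κ)
    {F : Over ((Functor.const Φ).obj Z)}
    (h : ∃ l : Problem g F → Ω, Function.Injective l) (ψ : Φ) :
    HasCardinalLT {q : Problem g F // bump q.φ (label g F q) ≤ ψ} κ :=
  (hsmall ψ).of_injective (fun q => ⟨label g F q.1, q.1.φ, q.2⟩) (fun q q' h' => by
    simp only [Subtype.mk.injEq] at h'
    exact Subtype.ext (label_injective g h h'))

lemma exists_tower (hbump : ∀ φ ω, φ ≤ bump φ ω) (κ : Cardinal.{v}) [Fact κ.IsRegular] [OrderBot κ.ord.ToType]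
    (hD : ∀ i, IsCardinalPresentable (D i) κ) (hE : ∀ i, IsCardinalPresentable (E i) κ)
    (hsmall : ∀ ψ, HasCardinalLT {ω : Ω // ∃ φ, bump φ ω ≤ ψ} κ)
    (hlabel : ∀ F : Over ((Functor.const Φ).obj Z),
      (∀ φ, IsCardinalPresentable (F.left.obj φ) κ) →
        ∃ l : Problem g F → Ω, Function.Injective l)
    (X₀ : Over ((Functor.const Φ).obj Z)) (hX₀ : ∀ φ, IsCardinalPresentable (X₀.left.obj φ) κ) :
    ∃ (G : κ.ord.ToType ⥤ Over ((Functor.const Φ).obj Z)) (_ : G.obj ⊥ ≅ X₀),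
      (∀ α φ, IsCardinalPresentable ((G.obj α).left.obj φ) κ) ∧
      (∀ α φ, (MorphismProperty.ofHoms g).rlp.llp
        ((G.map (homOfLE bot_le : ⊥ ⟶ α)).left.app φ)) ∧
      (∀ α (q : Problem g (G.obj α)), ∃ (β : κ.ord.ToType) (hβ : α ⟶ β) (ψ : Φ) (h : q.φ ⟶ ψ)
        (l : E q.i ⟶ (G.obj β).left.obj ψ),
        g q.i ≫ l = q.u ≫ (G.obj α).left.map h ≫ (G.map hβ).left.app ψ ∧
        l ≫ (G.obj β).hom.app ψ = q.v) := by
  have hno : NoMaxOrder κ.ord.ToType := Cardinal.noMaxOrder (Cardinal.IsRegular.aleph0_le Fact.out)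
  let S := towerStruct g bump hbump X₀
  let ev (φ : Φ) : Over ((Functor.const Φ).obj Z) ⥤ M :=
    Over.forget _ ⋙ (evaluation Φ M).obj φ
  refine ⟨S.iterationFunctor κ.ord.ToType, S.iterationFunctorObjBotIso κ.ord.ToType, ?_, ?_, ?_⟩
  · intro α
    induction α using SuccOrder.limitRecOn with
    | isMin j hj =>
      obtain rfl := hj.eq_bot
      intro φ
      have : IsCardinalPresentable ((ev φ).obj S.X₀) κ := hX₀ φ
      exact isCardinalPresentable_of_iso
        ((ev φ).mapIso (S.iterationFunctorObjBotIso κ.ord.ToType)).symm κ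
    | succ j hj hj' =>
      intro φ
      have : IsCardinalPresentable ((ev φ).obj
          (S.succ ((S.iterationFunctor κ.ord.ToType).obj j))) κ :=
        attach_isCardinalPresentable _ _ _ κ hD hE φ
          (label_stage_hasCardinalLT g bump hsmall (hlabel _ hj') φ) (hj' φ)
      exact isCardinalPresentable_of_iso
        ((ev φ).mapIso (S.iterationFunctorObjSuccIso j hj)).symm κ
    | isSuccLimit j hj hj' =>
      intro φ
      let F := S.iterationFunctor κ.ord.ToType
      have hc := isColimitOfPreserves (ev φ) (F.isColimitOfIsWellOrderContinuous j hj)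
      have (k : Set.Iio j) : IsCardinalPresentable
          ((((Set.principalSegIio j).monotone.functor ⋙ F) ⋙ ev φ).obj k) κ := hj' _ k.2 φ
      refine isCardinalPresentable_of_isColimit _ hc κ
        (hasCardinalLT_arrow_preorder ((hasCardinalLT_iff_cardinal_mk_lt _ _).2 ?_))
      simpa using Cardinal.mk_Iio_lt j (by simp)
  · intro α φ
    let t := S.transfiniteCompositionOfShapeιIteration κ.ord.ToType
    have hle : S.prop ≤ ((MorphismProperty.ofHoms g).rlp.llp).inverseImage (ev φ) := by
      rintro _ _ _ ⟨F⟩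
      exact toAttach_mem _ _ _ φ
    have : PreservesWellOrderContinuousOfShape κ.ord.ToType (ev φ) := { }
    exact MorphismProperty.transfiniteCompositionsOfShape_le _ _ _ (((t.ofLE hle).map).iic α).mem
  · intro α q
    have hα : ¬ IsMax α := not_isMax α
    let Gα := (S.iterationFunctor κ.ord.ToType).obj α
    have hs : ∃ l : E q.i ⟶ (S.succ Gα).left.obj (bump q.φ (label g _ q)),
        g q.i ≫ l = q.u ≫ Gα.left.map (homOfLE (hbump q.φ (label g _ q))) ≫
          (S.toSucc Gα).left.app _ ∧ l ≫ (S.succ Gα).hom.app _ = q.v :=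
      attach_solves (g := g) _ (fun q => bump q.φ (label g _ q)) (fun q => hbump _ _) q
    obtain ⟨l, h1, h2⟩ := hs
    let e := S.iterationFunctorObjSuccIso α hα
    refine ⟨Order.succ α, homOfLE (Order.le_succ α), _, homOfLE (hbump q.φ (label g _ q)),
      l ≫ e.inv.left.app _, ?_, ?_⟩
    · rw [S.iterationFunctor_map_succ α hα, reassoc_of% h1, Over.comp_left, NatTrans.comp_app]
    · rw [Category.assoc, ← NatTrans.comp_app, Over.w]
      exact h2

end Tower

/-- A type of labels, closed under forming families indexed by subsets of `K`. -/
inductive LabelTree (R K : Type v) : Type v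
  | mk (r : Option R) (t : Set K) (f : t → LabelTree R K) : LabelTree R K

instance (R K : Type v) : Nonempty (LabelTree R K) :=
  ⟨.mk none ∅ (fun x => x.2.elim)⟩

/-- The `κ`-small subsets of a type. -/
abbrev SmallSet (Ω : Type v) (κ : Cardinal.{v}) : Type v := {s : Set Ω // HasCardinalLT s κ}

lemma exists_injective_labelTree (R : Type v) (κ : Cardinal.{v}) :
    ∃ l : R × SmallSet (LabelTree R κ.ord.ToType) κ → LabelTree R κ.ord.ToType, Function.Injective l := by
  have h (s : SmallSet (LabelTree R κ.ord.ToType) κ) :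
      ∃ (t : Set κ.ord.ToType) (f : t → LabelTree R κ.ord.ToType), Set.range f = s.1 := by
    have h1 : Cardinal.mk s.1 ≤ Cardinal.mk κ.ord.ToType := by
      rw [Cardinal.mk_ord_toType]
      exact ((hasCardinalLT_iff_cardinal_mk_lt _ _).1 s.2).le
    obtain ⟨e⟩ := h1
    refine ⟨Set.range e, Subtype.val ∘ (Equiv.ofInjective e e.injective).symm, ?_⟩
    rw [Set.range_comp, (Equiv.surjective _).range_eq]
    simp
  choose t f hf using h
  refine ⟨fun x => .mk (some x.1) (t x.2) (f x.2), fun x y hxy => ?_⟩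
  have aux {t t' : Set κ.ord.ToType} (ht : t = t') {f : t → LabelTree R κ.ord.ToType}
      {f' : t' → LabelTree R κ.ord.ToType} (hff : f ≍ f') : Set.range f = Set.range f' := by
    subst ht
    rw [eq_of_heq hff]
  injection hxy with h1 h2 h3
  refine Prod.ext (Option.some.inj h1) (Subtype.ext ?_)
  rw [← hf, ← hf]
  exact aux h2 h3

lemma isCardinalFiltered_smallSet (Ω : Type v) (κ : Cardinal.{v}) [Fact κ.IsRegular] :
    IsCardinalFiltered (SmallSet Ω κ) κ := by
  refine isCardinalFiltered_preorder _ _ (fun ι f hι => ?_)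
  refine ⟨⟨⋃ i, (f i).1, ?_⟩, fun i => Set.subset_iUnion (fun i => (f i).1) i⟩
  exact hasCardinalLT_iUnion _ ((hasCardinalLT_iff_cardinal_mk_lt _ _).2 hι) (fun i => (f i).2)

open Classical in
/-- Adding an element to a `κ`-small set. -/
noncomputable def SmallSet.insert {Ω : Type v} {κ : Cardinal.{v}} [Fact κ.IsRegular]
    (s : SmallSet Ω κ) (ω : Ω) : SmallSet Ω κ :=
  ⟨Insert.insert ω s.1, by
    have hκ : Cardinal.aleph0 ≤ κ := Cardinal.IsRegular.aleph0_le Fact.out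
    rw [Set.insert_eq]
    exact hasCardinalLT_union hκ (hasCardinalLT_of_finite _ _ hκ) s.2⟩

section

variable {M : Type u} [Category.{v} M]

lemma exists_skeleton (κ : Cardinal.{v}) [Fact κ.IsRegular] [IsCardinalLocallyPresentable M κ] :
    ∃ (T : Type v) (G : T → M), ∀ X : M, IsCardinalPresentable X κ → ∃ t, Nonempty (X ≅ G t) := by
  obtain ⟨Q, _, h1, h2⟩ :=
    ObjectProperty.EssentiallySmall.exists_small_le.{v} (isCardinalPresentable M κ)
  refine ⟨Shrink.{v} (Subtype Q), fun t => ((equivShrink _).symm t).1, fun X hX => ?_⟩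
  obtain ⟨Y, hY, ⟨e⟩⟩ := h2 X hX
  exact ⟨equivShrink _ ⟨Y, hY⟩, ⟨e ≪≫ eqToIso (by simp)⟩⟩

lemma exists_directed_presentation (κ : Cardinal.{v}) [Fact κ.IsRegular]
    [IsCardinalLocallyPresentable M κ] (X : M) :
    ∃ (J : Type v) (_ : PartialOrder J) (_ : IsCardinalFiltered J κ) (F : J ⥤ M) (c : Cocone F)
      (_ : IsColimit c) (_ : c.pt ≅ X), ∀ j, IsCardinalPresentable (F.obj j) κ := by
  obtain ⟨J, _, _, ⟨p⟩⟩ :=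
    (isCardinalFilteredGenerator_isCardinalPresentable M κ).exists_colimitsOfShape X
  obtain ⟨α, _, _, F, _⟩ := IsCardinalFiltered.exists_cardinal_directed J κ
  exact ⟨α, inferInstance, inferInstance, F ⋙ p.diag, p.cocone.whisker F,
    (Functor.Final.isColimitWhiskerEquiv F _).symm p.isColimit, Iso.refl _,
    fun j => p.prop_diag_obj _⟩

end

section

variable {M : Type u} [Category.{v} M] {ι : Type v} {D E : ι → M} (g : ∀ i, D i ⟶ E i)

lemma desc_mem_rlp (κ : Cardinal.{v}) [Fact κ.IsRegular]
    (hD : ∀ i, IsCardinalPresentable (D i) κ)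
    {P : Type v} [SmallCategory P] [IsCardinalFiltered P κ] {H : P ⥤ M} {Z : M}
    (z : H ⟶ (Functor.const P).obj Z) {c : Cocone H} (hc : IsColimit c)
    (hz : ∀ (p : P) (i : ι) (u : D i ⟶ H.obj p) (v : E i ⟶ Z), u ≫ z.app p = g i ≫ v →
      ∃ (p' : P) (m : p ⟶ p') (l : E i ⟶ H.obj p'), g i ≫ l = u ≫ H.map m ∧
        l ≫ z.app p' = v) :
    (MorphismProperty.ofHoms g).rlp (hc.desc (Cocone.mk Z z)) := by
  rintro _ _ _ ⟨i⟩
  constructor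
  intro u v sq
  have := hD i
  obtain ⟨p, u', hu'⟩ := IsCardinalPresentable.exists_hom_of_isColimit κ hc u
  obtain ⟨p', m, l, h1, h2⟩ := hz p i u' v (by
    have := sq.w
    rw [← hu', Category.assoc, hc.fac] at this
    exact this)
  exact ⟨⟨{ l := l ≫ c.ι.app p'
            fac_left := by rw [reassoc_of% h1, c.w, hu']
            fac_right := by rw [Category.assoc, hc.fac]; exact h2 }⟩⟩

lemma exists_factor_of_system [HasColimits M] (κ : Cardinal.{v}) [Fact κ.IsRegular]
    (hD : ∀ i, IsCardinalPresentable (D i) κ)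
    {P : Type v} [SmallCategory P] [IsCardinalFiltered P κ] {K H : P ⥤ M} (s : K ⟶ H)
    (hK : ∀ p, IsCardinalPresentable (K.obj p) κ) (hH : ∀ p, IsCardinalPresentable (H.obj p) κ)
    (hs : ∀ p, (MorphismProperty.ofHoms g).rlp.llp (s.app p))
    {c : Cocone K} (hc : IsColimit c) {Z : M} (z : H ⟶ (Functor.const P).obj Z)
    (hz : ∀ (p : P) (i : ι) (u : D i ⟶ H.obj p) (v : E i ⟶ Z), u ≫ z.app p = g i ≫ v →
      ∃ (p' : P) (m : p ⟶ p') (l : E i ⟶ H.obj p'), g i ≫ l = u ≫ H.map m ∧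
        l ≫ z.app p' = v)
    (i : c.pt ⟶ Z) (hi : (MorphismProperty.ofHoms g).rlp.llp i)
    (hsz : ∀ p, s.app p ≫ z.app p = c.ι.app p ≫ i)
    {A C : M} (hA : IsCardinalPresentable A κ) (hC : IsCardinalPresentable C κ)
    (h : A ⟶ C) (a : A ⟶ c.pt) (b : C ⟶ Z) (w : a ≫ i = h ≫ b) :
    ∃ (A' C' : M) (k : A' ⟶ C') (a₁ : A ⟶ A') (a₂ : A' ⟶ c.pt) (b₁ : C ⟶ C') (b₂ : C' ⟶ Z),
      IsCardinalPresentable A' κ ∧ IsCardinalPresentable C' κ ∧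
      (MorphismProperty.ofHoms g).rlp.llp k ∧ a₁ ≫ a₂ = a ∧ b₁ ≫ b₂ = b ∧
      a₁ ≫ k = h ≫ b₁ ∧ k ≫ b₂ = a₂ ≫ i := by
  have hH' := colimit.isColimit H
  let q : colimit H ⟶ Z := hH'.desc (Cocone.mk Z z)
  have hιq (p : P) : colimit.ι H p ≫ q = z.app p := hH'.fac (Cocone.mk Z z) p
  have hq : (MorphismProperty.ofHoms g).rlp q := desc_mem_rlp g κ hD z hH' hz
  let x : c.pt ⟶ colimit H := hc.desc (Cocone.mk _ (s ≫ (colimit.cocone H).ι))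
  have hιx (p : P) : c.ι.app p ≫ x = s.app p ≫ colimit.ι H p := hc.fac _ p
  have hxq : x ≫ q = i := hc.hom_ext (fun p => by rw [reassoc_of% (hιx p), hιq, hsz])
  have sq : CommSq x i q (𝟙 Z) := ⟨by rw [hxq, Category.comp_id]⟩
  have := hi q hq
  obtain ⟨p₁, a', ha'⟩ := IsCardinalPresentable.exists_hom_of_isColimit κ hc a
  obtain ⟨p₂, b', hb'⟩ := IsCardinalPresentable.exists_hom_of_isColimit κ hH' (b ≫ sq.lift)
  obtain ⟨p, m₁, m₂, e⟩ := IsCardinalPresentable.exists_eq_of_isColimit κ hH'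
    (a' ≫ s.app p₁) (h ≫ b') (by
      rw [Category.assoc, Category.assoc, hb']
      refine (congrArg (a' ≫ ·) (hιx p₁).symm).trans ?_
      rw [reassoc_of% ha', ← reassoc_of% w, sq.fac_left])
  refine ⟨K.obj p, H.obj p, s.app p, a' ≫ K.map m₁, c.ι.app p, b' ≫ H.map m₂, z.app p, hK p,
    hH p, hs p, ?_, ?_, ?_, hsz p⟩
  · rw [Category.assoc, c.w, ha']
  · have h3 : H.map m₂ ≫ z.app p = z.app p₂ := (z.naturality m₂).trans (Category.comp_id _)
    have h4 : b' ≫ colimit.ι H p₂ = b ≫ sq.lift := hb'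
    rw [Category.assoc, h3, ← hιq, reassoc_of% h4,
      sq.fac_right, Category.comp_id]
  · rw [Category.assoc] at e ⊢
    rw [s.naturality, e, Category.assoc]

end

/-- The stages of the construction: an element of `J` together with a `κ`-small set of labels. -/
@[ext]
structure Stage (J Ω : Type v) (κ : Cardinal.{v}) : Type v where
  idx : J
  set : SmallSet Ω κ

instance (J Ω : Type v) [Preorder J] (κ : Cardinal.{v}) : Preorder (Stage J Ω κ) :=
  Preorder.lift (fun φ => (φ.idx, φ.set))

lemma Stage.le_iff {J Ω : Type v} [Preorder J] {κ : Cardinal.{v}} {φ ψ : Stage J Ω κ} :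
    φ ≤ ψ ↔ φ.idx ≤ ψ.idx ∧ φ.set.1 ⊆ ψ.set.1 :=
  Iff.rfl

/-- The projection from stages. -/
def Stage.proj (J Ω : Type v) [Preorder J] (κ : Cardinal.{v}) : Stage J Ω κ ⥤ J :=
  Monotone.functor (f := Stage.idx) (fun _ _ h => h.1)

instance (J Ω : Type v) [Preorder J] (κ : Cardinal.{v}) [Fact κ.IsRegular]
    [IsCardinalFiltered J κ] : IsCardinalFiltered (Stage J Ω κ) κ := by
  have := isCardinalFiltered_smallSet Ω κ
  refine isCardinalFiltered_preorder _ _ (fun ι f hι => ?_)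
  rw [← hasCardinalLT_iff_cardinal_mk_lt] at hι
  exact ⟨⟨IsCardinalFiltered.max (fun i => (f i).idx) hι,
    IsCardinalFiltered.max (fun i => (f i).set) hι⟩, fun i =>
    ⟨leOfHom (IsCardinalFiltered.toMax (fun i => (f i).idx) hι i),
      leOfHom (IsCardinalFiltered.toMax (fun i => (f i).set) hι i)⟩⟩

lemma Stage.proj_final (J Ω : Type v) [Preorder J] (κ : Cardinal.{v}) [Fact κ.IsRegular]
    [IsCardinalFiltered J κ] : (Stage.proj J Ω κ).Final := by
  have := isFiltered_of_isCardinalFiltered (Stage J Ω κ) κ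
  have := isCardinalFiltered_smallSet Ω κ
  have := IsCardinalFiltered.nonempty (SmallSet Ω κ) κ
  exact Functor.final_of_exists_of_isFiltered _
    (fun j => ⟨⟨j, Classical.arbitrary _⟩, ⟨𝟙 j⟩⟩)
    (fun {j φ} m m' => ⟨φ, 𝟙 φ, Subsingleton.elim _ _⟩)

section

variable {M : Type u} [Category.{v} M] {ι : Type v} {D E : ι → M} (g : ∀ i, D i ⟶ E i)

/-- The data determining a lifting problem up to the choice of a small set. -/
abbrev ProblemCode (J : Type v) {T : Type v} (G : T → M) (D E : ι → M) (Z : M) : Type v :=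
  J × (Σ i : ι, (Σ t : T, D i ⟶ G t) × (E i ⟶ Z))

lemma exists_problemCode (κ : Cardinal.{v}) [Fact κ.IsRegular] (J Ω : Type v) [Preorder J]
    {T : Type v} (G : T → M)
    (hG : ∀ X : M, IsCardinalPresentable X κ → ∃ t, Nonempty (X ≅ G t)) {Z : M}
    (F : Over ((Functor.const (Stage J Ω κ)).obj Z))
    (hF : ∀ φ, IsCardinalPresentable (F.left.obj φ) κ) :
    ∃ l : Problem g F → ProblemCode J G D E Z × SmallSet Ω κ, Function.Injective l := by
  choose t ht using fun φ => hG _ (hF φ)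
  let e (φ) : F.left.obj φ ≅ G (t φ) := (ht φ).some
  refine ⟨fun q => ⟨⟨q.φ.idx, ⟨q.i, ⟨⟨t q.φ, q.u ≫ (e q.φ).hom⟩, q.v⟩⟩⟩, q.φ.set⟩, ?_⟩
  rintro ⟨⟨j, s⟩, i, u, v, w⟩ ⟨⟨j', s'⟩, i', u', v', w'⟩ h
  simp only [Prod.mk.injEq] at h
  obtain ⟨⟨rfl, h⟩, rfl⟩ := h
  obtain ⟨rfl, h⟩ := Sigma.mk.inj h
  obtain ⟨h', rfl⟩ := Prod.mk.inj (eq_of_heq h)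
  have h := eq_of_heq (Sigma.mk.inj h').2
  obtain rfl := (cancel_mono _).1 h
  rfl

theorem exists_presentable_factor (κ : Cardinal.{v}) [Fact κ.IsRegular]
    [IsCardinalLocallyPresentable M κ]
    (hD : ∀ i, IsCardinalPresentable (D i) κ) (hE : ∀ i, IsCardinalPresentable (E i) κ)
    {X Z : M} (i : X ⟶ Z) (hi : (MorphismProperty.ofHoms g).rlp.llp i)
    {A C : M} (hA : IsCardinalPresentable A κ) (hC : IsCardinalPresentable C κ)
    (h : A ⟶ C) (a : A ⟶ X) (b : C ⟶ Z) (w : a ≫ i = h ≫ b) :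
    ∃ (A' C' : M) (k : A' ⟶ C') (a₁ : A ⟶ A') (a₂ : A' ⟶ X) (b₁ : C ⟶ C') (b₂ : C' ⟶ Z),
      IsCardinalPresentable A' κ ∧ IsCardinalPresentable C' κ ∧
      (MorphismProperty.ofHoms g).rlp.llp k ∧ a₁ ≫ a₂ = a ∧ b₁ ≫ b₂ = b ∧
      a₁ ≫ k = h ≫ b₁ ∧ k ≫ b₂ = a₂ ≫ i := by
  obtain ⟨J, _, _, F, c, hc, eX, hF⟩ := exists_directed_presentation κ X
  obtain ⟨T, G, hG⟩ := exists_skeleton (M := M) κ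
  have : Nonempty κ.ord.ToType := IsCardinalFiltered.nonempty _ κ
  let : OrderBot κ.ord.ToType := WellFoundedLT.toOrderBot κ.ord.ToType
  let Ω := LabelTree (ProblemCode J G D E Z) κ.ord.ToType
  let Φ := Stage J Ω κ
  let pr : Φ ⥤ J := Stage.proj J Ω κ
  have hpr : pr.Final := Stage.proj_final J Ω κ
  obtain ⟨L, hL⟩ := exists_injective_labelTree (ProblemCode J G D E Z) κ
  let X₀ : Over ((Functor.const Φ).obj Z) := Over.mk (Y := pr ⋙ F)
    { app := fun φ => c.ι.app (pr.obj φ) ≫ eX.hom ≫ i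
      naturality := fun φ ψ m => by
        have := c.w (pr.map m)
        simp [reassoc_of% this] }
  obtain ⟨G, e, h1, h2, h3⟩ := exists_tower g (Φ := Φ) (Ω := Ω) (Z := Z)
    (fun φ ω => ⟨φ.idx, φ.set.insert ω⟩) (fun φ ω => Stage.le_iff.2 ⟨le_rfl, Set.subset_insert ω φ.set.1⟩)
    κ hD hE
    (fun ψ => ψ.set.2.of_injective
      (fun ω => ⟨ω.1, (Stage.le_iff.1 ω.2.choose_spec).2 (Set.mem_insert ω.1 _)⟩)
      (fun ω ω' hω => Subtype.ext (Subtype.mk.inj hω)))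
    (fun F hF => by
      obtain ⟨l, hl⟩ := exists_problemCode g κ J Ω _ hG F hF
      exact ⟨L ∘ l, hL.comp hl⟩)
    X₀ (fun φ => hF φ.idx)
  let H : κ.ord.ToType × Φ ⥤ M := Functor.uncurry.obj (G ⋙ Over.forget _)
  let π : κ.ord.ToType × Φ ⥤ J := CategoryTheory.Prod.snd κ.ord.ToType Φ ⋙ pr
  have := isFiltered_of_isCardinalFiltered κ.ord.ToType κ
  have hπ : π.Final := Functor.final_comp _ _
  have he (φ : Φ) : IsIso (e.inv.left.app φ) :=
    ((Over.forget _ ⋙ (evaluation Φ M).obj φ).mapIso e.symm).isIso_hom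
  let s : π ⋙ F ⟶ H :=
    { app := fun p => e.inv.left.app p.2 ≫ (G.map (homOfLE bot_le : ⊥ ⟶ p.1)).left.app p.2
      naturality := fun p p' m => by
        have hn₁ := e.inv.left.naturality m.2
        have hn₂ := (G.map (homOfLE bot_le : ⊥ ⟶ p'.1)).left.naturality m.2
        have hn₃ : G.map (homOfLE bot_le : ⊥ ⟶ p'.1) =
            G.map (homOfLE bot_le : ⊥ ⟶ p.1) ≫ G.map m.1 := by
          rw [← G.map_comp]
          rfl
        have hn₄ : (G.map (homOfLE bot_le : ⊥ ⟶ p'.1)).left.app p.2 =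
            (G.map (homOfLE bot_le : ⊥ ⟶ p.1)).left.app p.2 ≫ (G.map m.1).left.app p.2 := by
          rw [hn₃]
          rfl
        rw [hn₄, Category.assoc] at hn₂
        have hn₅ := congrArg (· ≫ (G.map (homOfLE bot_le : ⊥ ⟶ p'.1)).left.app p'.2) hn₁
        rw [Category.assoc, Category.assoc, hn₂] at hn₅
        exact hn₅.trans (Category.assoc _ _ _).symm }
  let z : H ⟶ (Functor.const (κ.ord.ToType × Φ)).obj Z :=
    { app := fun p => (G.obj p.1).hom.app p.2
      naturality := fun p p' m => by
        have hn₁ := (G.obj p'.1).hom.naturality m.2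
        have hn₂ := NatTrans.congr_app (Over.w (G.map m.1)) p.2
        rw [NatTrans.comp_app] at hn₂
        have hn₃ := congrArg ((G.map m.1).left.app p.2 ≫ ·) hn₁
        refine (Category.assoc _ _ _).trans (hn₃.trans ?_)
        exact (Category.assoc _ _ _).symm.trans (congrArg (· ≫ 𝟙 Z) hn₂) }
  have hc' : IsColimit (c.whisker π) := (Functor.Final.isColimitWhiskerEquiv π _).symm hc
  obtain ⟨A', C', k, a₁, a₂, b₁, b₂, hA', hC', hk, ha, hb, h4, h5⟩ :=
    exists_factor_of_system g κ hD s (fun p => hF _) (fun p => h1 _ _)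
      (fun p => (MorphismProperty.cancel_left_of_respectsIso _ _ _).2 (h2 _ _)) hc' z
      (fun p i u v huv => by
        obtain ⟨β, hβ, ψ, m, l, hl1, hl2⟩ := h3 p.1 ⟨p.2, i, u, v, huv⟩
        exact ⟨(β, ψ), (hβ, m), l, hl1.trans (congrArg (u ≫ ·) ((G.map hβ).left.naturality m)), hl2⟩)
      (eX.hom ≫ i) ((MorphismProperty.cancel_left_of_respectsIso _ _ _).2 hi)
      (fun p => by
        have hn₁ := NatTrans.congr_app (Over.w (G.map (homOfLE bot_le : ⊥ ⟶ p.1))) p.2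
        have hn₂ := NatTrans.congr_app (Over.w e.inv) p.2
        rw [NatTrans.comp_app] at hn₁ hn₂
        refine (Category.assoc _ _ _).trans ?_
        exact (congrArg (e.inv.left.app p.2 ≫ ·) hn₁).trans hn₂) hA hC h (a ≫ eX.inv) b (by simpa using w)
  refine ⟨A', C', k, a₁, a₂ ≫ eX.hom, b₁, b₂, hA', hC', hk, ?_, hb, h4, ?_⟩
  · rw [reassoc_of% ha, Iso.inv_hom_id, Category.comp_id]
  · rw [h5, Category.assoc]

end

lemma isCardinalFiltered_iff_paper (J : Type v) [SmallCategory J] (κ : Cardinal.{v})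
    [Fact κ.IsRegular] : PaperAcc.IsCardinalFiltered J κ ↔ IsCardinalFiltered J κ := by
  constructor
  · intro h
    exact ⟨fun {A} _ F hA => h A ((hasCardinalLT_iff_cardinal_mk_lt _ _).1 hA) F⟩
  · intro h A _ hA F
    exact IsCardinalFiltered.nonempty_cocone F ((hasCardinalLT_iff_cardinal_mk_lt _ _).2 hA)

section

variable {M : Type u} [Category.{v} M] (κ : Cardinal.{v}) [Fact κ.IsRegular]

lemma isPresentable_iff (X : M) : PaperAcc.IsPresentable κ X ↔ IsCardinalPresentable X κ := by
  constructor
  · intro h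
    refine ⟨fun J _ hJ => ?_⟩
    exact (h J ((isCardinalFiltered_iff_paper J κ).2 hJ)).some
  · intro h J _ hJ
    have := (isCardinalFiltered_iff_paper J κ).1 hJ
    exact ⟨preservesColimitsOfShape_of_isCardinalPresentable X κ J⟩

lemma colimitsOfShape_of_presentation {P : Set M} {X : M}
    (p : PaperAcc.FilteredColimitPresentation κ P X) :
    ∃ (J : Type v) (_ : SmallCategory J) (_ : IsCardinalFiltered J κ),
      ObjectProperty.colimitsOfShape (fun Y => Y ∈ P) J X := by
  obtain ⟨J, hJ, F, hF, c, hc, e⟩ := p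
  refine ⟨J, inferInstance, (isCardinalFiltered_iff_paper J κ).1 hJ, ⟨{
    diag := F
    ι := c.ι ≫ (Functor.const J).map e.hom
    isColimit := hc.ofIsoColimit (Cocone.ext e)
    prop_diag_obj := hF }⟩⟩

lemma isCardinalLocallyPresentable_of_paper (h : PaperAcc.IsLocallyPresentable M κ) :
    IsCardinalLocallyPresentable M κ := by
  obtain ⟨_, ι, G, hG, h⟩ := h
  have hP : ObjectProperty.IsCardinalFilteredGenerator (C := M) (fun Y => Y ∈ Set.range G) κ :=
    { le_isCardinalPresentable := by
        rintro _ ⟨i, rfl⟩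
        exact (isPresentable_iff κ _).1 (hG i)
      exists_colimitsOfShape := fun X => colimitsOfShape_of_presentation κ (h X).some }
  have : ObjectProperty.Small.{v} (C := M) (fun Y => Y ∈ Set.range G) :=
    inferInstanceAs (Small.{v} (Set.range G))
  have := hP.hasCardinalFilteredGenerator
  exact { }

lemma llp_rlpOf {ι : Type v} {A B : ι → M} (f : ∀ i, A i ⟶ B i) :
    PaperAcc.Llp (PaperAcc.RlpOf f) = (MorphismProperty.ofHoms f).rlp.llp := by
  have h : PaperAcc.RlpOf f = (MorphismProperty.ofHoms f).rlp := by
    ext X Y p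
    constructor
    · rintro h _ _ _ ⟨i⟩
      exact h i
    · intro h i
      exact h _ ⟨i⟩
  rw [h]
  rfl

end

section

variable {M : Type u} [Category.{v} M] [HasColimits M] {ι : Type v} {D E : ι → M}
  (g : ∀ i, D i ⟶ E i)

/-- The generating morphisms in a functor category. -/
noncomputable def freeHom (K : Type v) [SmallCategory K] (x : K × ι) :
    (evaluationLeftAdjoint M x.1).obj (D x.2) ⟶ (evaluationLeftAdjoint M x.1).obj (E x.2) :=
  (evaluationLeftAdjoint M x.1).map (g x.2)

lemma rlp_freeHom_iff (K : Type v) [SmallCategory K] {F G : K ⥤ M} (τ : F ⟶ G) :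
    (MorphismProperty.ofHoms (freeHom g K)).rlp τ ↔
      ∀ k, (MorphismProperty.ofHoms g).rlp (τ.app k) := by
  constructor
  · rintro h k _ _ _ ⟨i⟩
    exact ((evaluationAdjunctionRight M k).hasLiftingProperty_iff (g i) τ).1 (h _ ⟨(k, i)⟩)
  · rintro h _ _ _ ⟨k, i⟩
    exact ((evaluationAdjunctionRight M k).hasLiftingProperty_iff (g i) τ).2 (h k _ ⟨i⟩)

lemma freeHom_app_mem (K : Type v) [SmallCategory K] (x : K × ι) (k : K) :
    (MorphismProperty.ofHoms g).rlp.llp ((freeHom g K x).app k) := by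
  have h : (freeHom g K x).app k = Limits.Sigma.map (fun _ : x.1 ⟶ k => g x.2) := by
    apply Sigma.hom_ext
    intro m
    simp only [freeHom, evaluationLeftAdjoint_map_app]
    exact (Sigma.ι_desc _ _).trans (Sigma.ι_map (fun _ : x.1 ⟶ k => g x.2) m).symm
  rw [h]
  exact MorphismProperty.colimMap _ (fun _ => MorphismProperty.le_llp_rlp _ _ ⟨x.2⟩)

lemma exists_projective_factorization (κ : Cardinal.{v}) [Fact κ.IsRegular]
    (hD : ∀ i, IsCardinalPresentable (D i) κ) {K : Type v} [SmallCategory K] {F G : K ⥤ M}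
    (τ : F ⟶ G) :
    ∃ (H : K ⥤ M) (i : F ⟶ H) (p : H ⟶ G), i ≫ p = τ ∧
      (∀ k, (MorphismProperty.ofHoms g).rlp.llp (i.app k)) ∧
      (∀ k, (MorphismProperty.ofHoms g).rlp (p.app k)) ∧
      (MorphismProperty.ofHoms (freeHom g K)).rlp.llp i := by
  have : Nonempty κ.ord.ToType := IsCardinalFiltered.nonempty _ κ
  let : OrderBot κ.ord.ToType := WellFoundedLT.toOrderBot κ.ord.ToType
  let I := MorphismProperty.ofHoms (freeHom g K)
  have hI : I.IsCardinalForSmallObjectArgument κ :=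
    { preservesColimit := by
        rintro _ _ _ _ _ ⟨k, i⟩ f hf
        have := hD i
        have : ((evaluation K M).obj k).IsCardinalAccessible κ := ⟨fun _ _ _ => inferInstance⟩
        have := (evaluationAdjunctionRight M k).isCardinalPresentable_leftAdjoint_obj κ (D i)
        have := preservesColimitsOfShape_of_isCardinalPresentable
          ((evaluationLeftAdjoint M k).obj (D i)) κ κ.ord.ToType
        exact (this.preservesColimit : _) }
  have : I.HasSmallObjectArgument := ⟨κ, inferInstance, inferInstance, hI⟩
  let d := MorphismProperty.factorizationData I.rlp.llp I.rlp τ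
  refine ⟨d.Z, d.i, d.p, d.fac, fun k => ?_, (rlp_freeHom_iff g K _).1 d.hp, d.hi⟩
  let L := (MorphismProperty.ofHoms g).rlp.llp
  have hle : I ≤ L.functorCategory K := by
    rintro _ _ _ ⟨x⟩ k
    exact freeHom_app_mem g K x k
  have : MorphismProperty.IsStableUnderCoproducts.{v} (L.functorCategory K) := ⟨fun J => inferInstance⟩
  have h1 := (SmallObject.llp_rlp_of_isCardinalForSmallObjectArgument' I κ).le _ d.hi
  have h2 : (MorphismProperty.coproducts.{v} I).pushouts ≤ L.functorCategory K :=
    MorphismProperty.pushouts_le_iff.2 (MorphismProperty.coproducts_le_iff.2 hle)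
  have h3 : (MorphismProperty.transfiniteCompositionsOfShape (MorphismProperty.coproducts.{v} I).pushouts
      κ.ord.ToType).retracts ≤ L.functorCategory K :=
    (MorphismProperty.retracts_monotone
      ((MorphismProperty.transfiniteCompositionsOfShape_monotone _ h2).trans
        (MorphismProperty.transfiniteCompositionsOfShape_le _ _))).trans
      (MorphismProperty.retracts_le _)
  exact h3 _ h1 k

end

section

variable {M : Type u} [Category.{v} M] (S : PaperAcc.ModelStructure M)

lemma weakEquivalence_of_rlp_cof {X Y : M} (p : X ⟶ Y) (hp : S.Cof.rlp p) : S.W p := by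
  obtain ⟨Z, i, q, hi, -, hq, fac⟩ := S.fact_cof_trivFib p
  have := hp i hi
  have sq : CommSq (𝟙 X) i p q := ⟨by rw [fac, Category.id_comp]⟩
  exact S.W_retract p q i sq.lift (𝟙 Y) (𝟙 Y) sq.fac_left (Category.id_comp _)
    (by rw [fac, Category.comp_id]) (by rw [sq.fac_right, Category.comp_id]) hq

lemma rlp_cof_of_weakEquivalence {X Y : M} (p : X ⟶ Y) (hp : (S.Cof ⊓ S.W).rlp p)
    (hw : S.W p) : S.Cof.rlp p := by
  obtain ⟨Z, i, q, hi, hfq, hq, fac⟩ := S.fact_cof_trivFib p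
  have := hp i ⟨hi, S.W_of_comp_right i q hq (by rw [fac]; exact hw)⟩
  have sq : CommSq (𝟙 X) i p q := ⟨by rw [fac, Category.id_comp]⟩
  intro A B c hc
  have := S.lift_cof_trivFib c q hc hfq hq
  refine ⟨fun {u v} sq' => ?_⟩
  have sq'' : CommSq (u ≫ i) c q v := ⟨by rw [Category.assoc, fac, sq'.w]⟩
  refine ⟨⟨⟨sq''.lift ≫ sq.lift, ?_, ?_⟩⟩⟩
  · rw [sq''.fac_left_assoc, Category.assoc, sq.fac_left, Category.comp_id]
  · rw [Category.assoc, sq.fac_right, sq''.fac_right]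

end

section

variable {M : Type u} [Category.{v} M] {ι : Type v} {D E : ι → M} (g : ∀ i, D i ⟶ E i)
  (κ : Cardinal.{v}) [Fact κ.IsRegular] {K : Type v} [SmallCategory K]

lemma rlp_colimit [IsCardinalFiltered K κ]
    (hD : ∀ i, IsCardinalPresentable (D i) κ) (hE : ∀ i, IsCardinalPresentable (E i) κ)
    {F G : K ⥤ M} (τ : F ⟶ G) (hτ : ∀ k, (MorphismProperty.ofHoms g).rlp (τ.app k))
    {cF : Cocone F} {cG : Cocone G} (hcF : IsColimit cF) (hcG : IsColimit cG)
    (φ : cF.pt ⟶ cG.pt) (hφ : ∀ k, cF.ι.app k ≫ φ = τ.app k ≫ cG.ι.app k) :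
    (MorphismProperty.ofHoms g).rlp φ := by
  rintro _ _ _ ⟨i⟩
  refine ⟨fun {a b} sq => ?_⟩
  have := hD i
  have := hE i
  have := isFiltered_of_isCardinalFiltered K κ
  obtain ⟨k₁, a', ha⟩ := IsCardinalPresentable.exists_hom_of_isColimit κ hcF a
  obtain ⟨k₂, b', hb⟩ := IsCardinalPresentable.exists_hom_of_isColimit κ hcG b
  obtain ⟨k, s, t, hst⟩ := IsCardinalPresentable.exists_eq_of_isColimit κ hcG
    (a' ≫ τ.app k₁) (g i ≫ b') (by
      rw [Category.assoc, Category.assoc, ← hφ, ← Category.assoc, ha, hb, sq.w])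
  have := hτ k _ ⟨i⟩
  have sq' : CommSq (a' ≫ F.map s) (g i) (τ.app k) (b' ≫ G.map t) :=
    ⟨by rw [Category.assoc, τ.naturality, ← Category.assoc, hst, Category.assoc]⟩
  refine ⟨⟨⟨sq'.lift ≫ cF.ι.app k, ?_, ?_⟩⟩⟩
  · rw [sq'.fac_left_assoc, Category.assoc, cF.w, ha]
  · rw [Category.assoc, hφ, sq'.fac_right_assoc, Category.assoc, cG.w, hb]

lemma llp_rlp_colimit [HasColimits M] {F G : K ⥤ M} (τ : F ⟶ G)
    (hτ : (MorphismProperty.ofHoms (freeHom g K)).rlp.llp τ)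
    {cF : Cocone F} {cG : Cocone G} (hcF : IsColimit cF) (hcG : IsColimit cG)
    (φ : cF.pt ⟶ cG.pt) (hφ : ∀ k, cF.ι.app k ≫ φ = τ.app k ≫ cG.ι.app k) :
    (MorphismProperty.ofHoms g).rlp.llp φ := by
  intro X Y q hq
  refine ⟨fun {a b} sq => ?_⟩
  have := hτ ((Functor.const K).map q) ((rlp_freeHom_iff g K _).2 (fun _ => hq))
  have sq' : CommSq (cF.ι ≫ (Functor.const K).map a) τ ((Functor.const K).map q)
      (cG.ι ≫ (Functor.const K).map b) := by
    refine ⟨?_⟩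
    ext k
    change (cF.ι.app k ≫ a) ≫ q = τ.app k ≫ cG.ι.app k ≫ b
    rw [Category.assoc, sq.w, ← Category.assoc, hφ, Category.assoc]
  refine ⟨⟨⟨hcG.desc ⟨X, sq'.lift⟩, ?_, ?_⟩⟩⟩
  · apply hcF.hom_ext
    intro k
    rw [← Category.assoc, hφ, Category.assoc, hcG.fac]
    exact congr_app sq'.fac_left k
  · apply hcG.hom_ext
    intro k
    rw [hcG.fac_assoc]
    exact congr_app sq'.fac_right k

end

lemma closedUnderFilteredColimits_weakEquivalences {M : Type u} [Category.{v} M] [HasColimits M]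
    (S : PaperAcc.ModelStructure M) (κ : Cardinal.{v}) [Fact κ.IsRegular]
    (hI : PaperAcc.CofibrantlyGeneratedByPresentables κ S.Cof)
    (hJ : PaperAcc.CofibrantlyGeneratedByPresentables κ (S.Cof ⊓ S.W)) :
    PaperAcc.ClosedUnderFilteredColimits κ {a : Arrow M | S.W a.hom} := by
  obtain ⟨ιI, AI, BI, gI, hAI, hBI, hI⟩ := hI
  obtain ⟨ιJ, AJ, BJ, gJ, hAJ, hBJ, hJ⟩ := hJ
  simp only [isPresentable_iff] at hAI hBI hAJ hBJ
  rw [llp_rlpOf] at hI hJ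
  intro K _ hK F c hc hF
  rw [isCardinalFiltered_iff_paper] at hK
  obtain ⟨H, i, p, fac, hi, hp, hi'⟩ := exists_projective_factorization gJ κ hAJ
    (Functor.whiskerLeft F Arrow.leftToRight)
  have hp' : ∀ k, (MorphismProperty.ofHoms gI).rlp (p.app k) := by
    intro k
    rw [← MorphismProperty.rlp_llp_rlp, ← hI]
    refine rlp_cof_of_weakEquivalence S _ ?_ ?_
    · rw [hJ, MorphismProperty.rlp_llp_rlp]
      exact hp k
    · refine S.W_of_comp_left (i.app k) (p.app k) ?_ ?_
      · have := hi k
        rw [← hJ] at this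
        exact this.2
      · rw [← NatTrans.comp_app, fac]
        exact hF k
  have hcl : IsColimit (Arrow.leftFunc.mapCocone c) := isColimitOfPreserves _ hc
  have hcr : IsColimit (Arrow.rightFunc.mapCocone c) := isColimitOfPreserves _ hc
  have hH := colimit.isColimit H
  let α : c.pt.left ⟶ colimit H := hcl.desc ⟨colimit H, i ≫ (colimit.cocone H).ι⟩
  let β : colimit H ⟶ c.pt.right :=
    colimit.desc H ⟨c.pt.right, p ≫ (Arrow.rightFunc.mapCocone c).ι⟩
  have hα : S.W α := by
    have : (MorphismProperty.ofHoms gJ).rlp.llp α :=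
      llp_rlp_colimit gJ i hi' hcl hH α (fun k => hcl.fac _ k)
    rw [← hJ] at this
    exact this.2
  have hβ : S.W β := by
    refine weakEquivalence_of_rlp_cof S _ ?_
    rw [hI, MorphismProperty.rlp_llp_rlp]
    exact rlp_colimit gI κ hAI hBI p hp' hH hcr β (fun k => colimit.ι_desc _ k)
  have hαβ : α ≫ β = c.pt.hom := by
    apply hcl.hom_ext
    intro k
    let ik : (F.obj k).left ⟶ H.obj k := i.app k
    let pk : H.obj k ⟶ (F.obj k).right := p.app k
    have h1 : (c.ι.app k).left ≫ α = ik ≫ colimit.ι H k := hcl.fac _ k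
    have h2 : colimit.ι H k ≫ β = pk ≫ (c.ι.app k).right := colimit.ι_desc _ k
    have h3 : ik ≫ pk = (F.obj k).hom := congr_app fac k
    have h4 : (c.ι.app k).left ≫ α ≫ β = (F.obj k).hom ≫ (c.ι.app k).right := by
      rw [reassoc_of% h1, h2, reassoc_of% h3]
    exact h4.trans (Arrow.w (c.ι.app k)).symm
  change S.W c.pt.hom
  rw [← hαβ]
  exact S.W_comp _ _ hα hβ

section

variable {M : Type u} [Category.{v} M] (S : PaperAcc.ModelStructure M)

lemma isStableUnderCobaseChange_of_cofibrantlyGenerated {κ : Cardinal.{v}}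
    {C : MorphismProperty M} (hC : PaperAcc.CofibrantlyGeneratedByPresentables κ C) :
    C.IsStableUnderCobaseChange := by
  obtain ⟨_, _, _, g, _, _, rfl⟩ := hC
  rw [llp_rlpOf]
  infer_instance

lemma isMultiplicative_of_cofibrantlyGenerated {κ : Cardinal.{v}}
    {C : MorphismProperty M} (hC : PaperAcc.CofibrantlyGeneratedByPresentables κ C) :
    C.IsMultiplicative := by
  obtain ⟨_, _, _, g, _, _, rfl⟩ := hC
  rw [llp_rlpOf]
  infer_instance

lemma llp_rlp_of_cofibrantlyGenerated {κ : Cardinal.{v}}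
    {C : MorphismProperty M} (hC : PaperAcc.CofibrantlyGeneratedByPresentables κ C) :
    C.rlp.llp = C := by
  obtain ⟨_, _, _, g, _, _, rfl⟩ := hC
  rw [llp_rlpOf, MorphismProperty.rlp_llp_rlp]

variable {S}

lemma cofibrant_of_cof [HasInitial M] [S.Cof.IsMultiplicative] {A B : M} (i : A ⟶ B)
    (hA : PaperAcc.Cofibrant S A) (hi : S.Cof i) : PaperAcc.Cofibrant S B := by
  intro O hO f
  rw [hO.hom_ext f (hO.to A ≫ i)]
  exact S.Cof.comp_mem _ _ (hA hO _) hi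

lemma weakEquivalence_of_isFormalCofibration [(S.Cof ⊓ S.W).IsStableUnderCobaseChange]
    {P Q B C : M} {m : P ⟶ Q} {r : P ⟶ B} {h : Q ⟶ C} {k : B ⟶ C}
    (hm : PaperAcc.IsFormalCofibration S m) (hB : PaperAcc.Cofibrant S B) (hr : S.W r)
    (sq : IsPushout m r h k) : S.W h := by
  obtain ⟨A', B', X', P', wA, i, wB, j, wX, pB, pX, t, -, hwA, -, hwB, hj, hwX, -, fac, sq', fac',
    -, ht⟩ := hm r h k hB sq
  have hj' : S.W j := S.W_of_comp_right j wX hwX (by rw [fac]; exact S.W_comp _ _ hwA hr)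
  have hpB : (S.Cof ⊓ S.W) pB :=
    MorphismProperty.of_isPushout (P := S.Cof ⊓ S.W) sq' ⟨hj, hj'⟩
  exact S.W_of_comp_left wB h hwB (by rw [← fac']; exact S.W_comp _ _ hpB.2 ht)

end

section

variable {M : Type u} [Category.{v} M] [HasColimits M] {S : PaperAcc.ModelStructure M}

lemma cof_cylinder_desc {A : M} (cyl : PaperAcc.CylinderObject S A) :
    S.Cof (coprod.desc cyl.i₀ cyl.i₁) := by
  have h : coprod.desc cyl.i₀ cyl.i₁ =
      (coprodIsCoprod A A).desc (BinaryCofan.mk cyl.i₀ cyl.i₁) := by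
    apply coprod.hom_ext
    · rw [coprod.inl_desc]
      exact ((coprodIsCoprod A A).fac (BinaryCofan.mk cyl.i₀ cyl.i₁) ⟨.left⟩).symm
    · rw [coprod.inr_desc]
      exact ((coprodIsCoprod A A).fac (BinaryCofan.mk cyl.i₀ cyl.i₁) ⟨.right⟩).symm
  rw [h]
  exact cyl.hcof _ _

lemma cof_cylinder_right (hS : S.Cof.rlp.llp = S.Cof) {A : M} (hA : PaperAcc.Cofibrant S A)
    (cyl : PaperAcc.CylinderObject S A) : S.Cof cyl.i₁ := by
  rw [← hS]
  intro X Y p hp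
  refine ⟨fun {u v} sq => ?_⟩
  have := hp _ (hA initialIsInitial (initial.to A))
  have sq₁ : CommSq (initial.to X) (initial.to A) p (cyl.i₀ ≫ v) := ⟨by ext⟩
  have := hp _ (cof_cylinder_desc cyl)
  have sq₂ : CommSq (coprod.desc sq₁.lift u) (coprod.desc cyl.i₀ cyl.i₁) p v := by
    refine ⟨coprod.hom_ext ?_ ?_⟩
    · rw [coprod.inl_desc_assoc, coprod.inl_desc_assoc, sq₁.fac_right]
    · rw [coprod.inr_desc_assoc, coprod.inr_desc_assoc, sq.w]
  refine ⟨⟨⟨sq₂.lift, ?_, sq₂.fac_right⟩⟩⟩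
  have h := coprod.inr ≫= sq₂.fac_left
  rwa [coprod.inr_desc, coprod.inr_desc_assoc] at h

lemma cof_mappingCylinder (hS : S.Cof.rlp.llp = S.Cof) {A B C : M}
    (hB : PaperAcc.Cofibrant S B) (cyl : PaperAcc.CylinderObject S A) (g : A ⟶ B)
    {s : cyl.C ⟶ C} {t : B ⟶ C} (po : IsPushout cyl.i₁ g s t) : S.Cof (cyl.i₀ ≫ s) := by
  rw [← hS]
  intro X Y p hp
  refine ⟨fun {u v} sq => ?_⟩
  have := hp _ (hB initialIsInitial (initial.to B))
  have sq₁ : CommSq (initial.to X) (initial.to B) p (t ≫ v) := ⟨by ext⟩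
  have := hp _ (cof_cylinder_desc cyl)
  have sq₂ : CommSq (coprod.desc u (g ≫ sq₁.lift)) (coprod.desc cyl.i₀ cyl.i₁) p (s ≫ v) := by
    refine ⟨coprod.hom_ext ?_ ?_⟩
    · rw [coprod.inl_desc_assoc, coprod.inl_desc_assoc, sq.w, Category.assoc]
    · rw [coprod.inr_desc_assoc, coprod.inr_desc_assoc, Category.assoc, sq₁.fac_right,
        ← po.w_assoc]
  have h₀ := coprod.inl ≫= sq₂.fac_left
  have h₁ := coprod.inr ≫= sq₂.fac_left
  rw [coprod.inl_desc, coprod.inl_desc_assoc] at h₀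
  rw [coprod.inr_desc, coprod.inr_desc_assoc] at h₁
  refine ⟨⟨⟨po.desc sq₂.lift sq₁.lift h₁, ?_, ?_⟩⟩⟩
  · rw [Category.assoc, po.inl_desc, h₀]
  · apply po.hom_ext
    · rw [po.inl_desc_assoc, sq₂.fac_right]
    · rw [po.inr_desc_assoc, sq₁.fac_right]

lemma exists_mappingCylinder (κ : Cardinal.{v}) [Fact κ.IsRegular]
    (hS : S.Cof.rlp.llp = S.Cof) [(S.Cof ⊓ S.W).IsStableUnderCobaseChange] {A B : M}
    (hA : PaperAcc.Cofibrant S A) (hB : PaperAcc.Cofibrant S B)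
    (hA' : IsCardinalPresentable A κ) (hB' : IsCardinalPresentable B κ)
    (cyl : PaperAcc.CylinderObject S A) (hcyl : IsCardinalPresentable cyl.C κ) (g : A ⟶ B) :
    ∃ (C : M) (j : A ⟶ C) (r : C ⟶ B), j ≫ r = g ∧ S.Cof j ∧ S.W r ∧
      IsCardinalPresentable C κ := by
  have po := IsPushout.of_hasPushout cyl.i₁ g
  have hw : cyl.i₁ ≫ cyl.p ≫ g = g ≫ 𝟙 B := by
    rw [← Category.assoc, cyl.hi₁, Category.id_comp, Category.comp_id]
  have h₁ : (S.Cof ⊓ S.W) cyl.i₁ := ⟨cof_cylinder_right hS hA cyl,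
    S.W_of_comp_right _ cyl.p cyl.hp (by rw [cyl.hi₁]; exact S.W_id _)⟩
  have h₂ : (S.Cof ⊓ S.W) (pushout.inr cyl.i₁ g) :=
    MorphismProperty.of_isPushout (P := S.Cof ⊓ S.W) po.flip h₁
  refine ⟨_, cyl.i₀ ≫ pushout.inl cyl.i₁ g, po.desc (cyl.p ≫ g) (𝟙 B) hw, ?_,
    cof_mappingCylinder hS hB cyl g po, ?_, isCardinalPresentable_of_isPushout po κ hA' hcyl hB'⟩
  · rw [Category.assoc, po.inl_desc, ← Category.assoc, cyl.hi₀, Category.id_comp]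
  · exact S.W_of_comp_left _ _ h₂.2 (by rw [po.inr_desc]; exact S.W_id _)

end

lemma exists_presentable_weakEquivalence_factor {M : Type u} [Category.{v} M]
    {S : PaperAcc.ModelStructure M} (κ : Cardinal.{v}) [Fact κ.IsRegular]
    [IsCardinalLocallyPresentable M κ]
    (hI : PaperAcc.CofibrantlyGeneratedByPresentables κ S.Cof)
    (hJ : PaperAcc.CofibrantlyGeneratedByPresentables κ (S.Cof ⊓ S.W))
    (hformal : ∀ {P Q R : M} (i : P ⟶ Q) (q : Q ⟶ R), S.Cof (i ≫ q) →
      PaperAcc.Cofibrant S P → PaperAcc.Cofibrant S R → PaperAcc.IsFormalCofibration S i)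
    {A B : M} (hA : PaperAcc.Cofibrant S A) (hB : PaperAcc.Cofibrant S B)
    (hA' : IsCardinalPresentable A κ) (hB' : IsCardinalPresentable B κ)
    (cyl : PaperAcc.CylinderObject S A) (hcyl : IsCardinalPresentable cyl.C κ) (g : A ⟶ B)
    {X Y : M} (f : X ⟶ Y) (hf : S.W f) (a : A ⟶ X) (b : B ⟶ Y) (w : a ≫ f = g ≫ b) :
    ∃ (A' B' : M) (g' : A' ⟶ B') (a₁ : A ⟶ A') (a₂ : A' ⟶ X) (b₁ : B ⟶ B') (b₂ : B' ⟶ Y),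
      IsCardinalPresentable A' κ ∧ IsCardinalPresentable B' κ ∧ S.W g' ∧
      a₁ ≫ a₂ = a ∧ b₁ ≫ b₂ = b ∧ a₁ ≫ g' = g ≫ b₁ ∧ g' ≫ b₂ = a₂ ≫ f := by
  have := isStableUnderCobaseChange_of_cofibrantlyGenerated hI
  have := isMultiplicative_of_cofibrantlyGenerated hI
  have := isStableUnderCobaseChange_of_cofibrantlyGenerated hJ
  have hS := llp_rlp_of_cofibrantlyGenerated hI
  obtain ⟨C, j, r, hjr, hj, hr, hC'⟩ := exists_mappingCylinder κ hS hA hB hA' hB' cyl hcyl g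
  obtain ⟨X', a', q, ha', -, hq, haq⟩ := S.fact_cof_trivFib a
  have po := IsPushout.of_hasPushout j a'
  obtain ⟨Z, k, p, hk, -, hp, hkp⟩ := S.fact_cof_trivFib (po.desc (r ≫ b) (q ≫ f)
    (by rw [reassoc_of% hjr, reassoc_of% haq, w]))
  have h₁ : S.Cof (pushout.inl j a' ≫ k) :=
    S.Cof.comp_mem _ _ (MorphismProperty.of_isPushout (P := S.Cof) po ha') hk
  have h₂ : S.Cof (pushout.inr j a' ≫ k) :=
    S.Cof.comp_mem _ _ (MorphismProperty.of_isPushout (P := S.Cof) po.flip hj) hk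
  have e₁ : pushout.inl j a' ≫ k ≫ p = r ≫ b := by rw [hkp, po.inl_desc]
  have e₂ : pushout.inr j a' ≫ k ≫ p = q ≫ f := by rw [hkp, po.inr_desc]
  have h₃ : S.W (pushout.inr j a' ≫ k) :=
    S.W_of_comp_right _ p hp (by rw [Category.assoc, e₂]; exact S.W_comp _ _ hq hf)
  have hX' := cofibrant_of_cof a' hA ha'
  obtain ⟨ι, D, E, gJ, hD, hE, hJ⟩ := hJ
  rw [llp_rlpOf] at hJ
  simp only [isPresentable_iff] at hD hE
  have h₄ : (MorphismProperty.ofHoms gJ).rlp.llp (pushout.inr j a' ≫ k) := by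
    rw [← hJ]
    exact ⟨h₂, h₃⟩
  obtain ⟨A', C', g', a₁, a₂, m, c₂, hA'', hC'', hg', ea, ec, e₃, e₄⟩ :=
    exists_presentable_factor gJ κ hD hE _ h₄ hA' hC' j a' (pushout.inl j a' ≫ k)
      (by rw [← po.w_assoc])
  rw [← hJ] at hg'
  have hm : PaperAcc.IsFormalCofibration S m := hformal m c₂ (by rw [ec]; exact h₁)
    (cofibrant_of_cof j hA hj) (cofibrant_of_cof _ hX' h₂)
  have po' := IsPushout.of_hasPushout m r
  have h₅ := weakEquivalence_of_isFormalCofibration hm hB hr po'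
  have hw : m ≫ c₂ ≫ p = r ≫ b := by rw [reassoc_of% ec, e₁]
  refine ⟨A', _, g' ≫ pushout.inl m r, a₁, a₂ ≫ q, pushout.inr m r, po'.desc (c₂ ≫ p) b hw, hA'',
    isCardinalPresentable_of_isPushout po' κ hC' hC'' hB', S.W_comp _ _ hg'.2 h₅, ?_,
    po'.inr_desc _ _ _, ?_, ?_⟩
  · rw [reassoc_of% ea, haq]
  · rw [reassoc_of% e₃, po'.w, reassoc_of% hjr]
  · rw [Category.assoc, po'.inl_desc, reassoc_of% e₄, e₂, Category.assoc]

section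

variable {M : Type u} [Category.{v} M]

/-- The functor sending an object to its identity arrow. -/
def idArrow (M : Type u) [Category.{v} M] : M ⥤ Arrow M where
  obj G := Arrow.mk (𝟙 G)
  map h := Arrow.homMk h h (by simp)

/-- The morphism from an identity arrow given by a morphism to the source. -/
def idArrowHom {G : M} {f : Arrow M} (h : G ⟶ f.left) : (idArrow M).obj G ⟶ f :=
  Arrow.homMk h (h ≫ f.hom) (Category.id_comp _).symm

/-- The identity arrow functor is left adjoint to the source functor. -/
def idArrowAdj (M : Type u) [Category.{v} M] : idArrow M ⊣ Arrow.leftFunc :=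
  Adjunction.mkOfHomEquiv
    { homEquiv _ _ :=
        { toFun φ := φ.left
          invFun h := idArrowHom h
          left_inv φ := Arrow.hom_ext _ _ rfl
            ((Arrow.w φ).trans (Category.id_comp _))
          right_inv _ := rfl }
      homEquiv_naturality_left_symm _ _ := Arrow.hom_ext _ _ rfl (Category.assoc _ _ _)
      homEquiv_naturality_right _ _ := rfl }

variable [HasInitial M]

/-- The functor sending an object to the arrow from the initial object. -/
noncomputable def initialArrow (M : Type u) [Category.{v} M] [HasInitial M] : M ⥤ Arrow M where
  obj G := Arrow.mk (initial.to G)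
  map h := Arrow.homMk (𝟙 _) h (initialIsInitial.hom_ext _ _)
  map_comp _ _ := Arrow.hom_ext _ _ (initialIsInitial.hom_ext _ _) rfl

/-- The morphism from `initialArrow` given by a morphism to the target. -/
noncomputable def initialArrowHom {G : M} {f : Arrow M} (h : G ⟶ f.right) :
    (initialArrow M).obj G ⟶ f :=
  Arrow.homMk (initial.to _) h (initialIsInitial.hom_ext _ _)

/-- The functor `initialArrow` is left adjoint to the target functor. -/
noncomputable def initialArrowAdj (M : Type u) [Category.{v} M] [HasInitial M] :
    initialArrow M ⊣ Arrow.rightFunc :=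
  Adjunction.mkOfHomEquiv
    { homEquiv _ _ :=
        { toFun φ := φ.right
          invFun h := initialArrowHom h
          left_inv _ := Arrow.hom_ext _ _ (initialIsInitial.hom_ext _ _) rfl
          right_inv _ := rfl }
      homEquiv_naturality_left_symm _ _ :=
        Arrow.hom_ext _ _ (initialIsInitial.hom_ext _ _) rfl
      homEquiv_naturality_right _ _ := rfl }

end

section

variable {M : Type u} [Category.{v} M] [HasColimits M] (κ : Cardinal.{v}) [Fact κ.IsRegular]

lemma isCardinalPresentable_idArrow (G : M) (hG : IsCardinalPresentable G κ) :
    IsCardinalPresentable ((idArrow M).obj G) κ :=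
  have : (Arrow.leftFunc (C := M)).IsCardinalAccessible κ := ⟨fun _ _ _ => inferInstance⟩
  (idArrowAdj M).isCardinalPresentable_leftAdjoint_obj κ G

lemma isCardinalPresentable_initialArrow (G : M) (hG : IsCardinalPresentable G κ) :
    IsCardinalPresentable ((initialArrow M).obj G) κ :=
  have : (Arrow.rightFunc (C := M)).IsCardinalAccessible κ := ⟨fun _ _ _ => inferInstance⟩
  (initialArrowAdj M).isCardinalPresentable_leftAdjoint_obj κ G

lemma isPushout_arrow {A B : M} (h : A ⟶ B) :
    IsPushout (Arrow.homMk (initial.to A) (𝟙 A) (initialIsInitial.hom_ext _ _) :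
        (initialArrow M).obj A ⟶ (idArrow M).obj A)
      ((initialArrow M).map h)
      (Arrow.homMk (𝟙 A) h (by exact rfl) : (idArrow M).obj A ⟶ Arrow.mk h)
      (Arrow.homMk (initial.to A) (𝟙 B) (initialIsInitial.hom_ext _ _) :
        (initialArrow M).obj B ⟶ Arrow.mk h) := by
  refine ⟨⟨Arrow.hom_ext _ _ (initialIsInitial.hom_ext _ _) ?_⟩,
    ⟨PushoutCocone.IsColimit.mk _
      (fun s => Arrow.homMk s.inl.left s.inr.right ?_) (fun s => ?_) (fun s => ?_)
      (fun s m h₁ h₂ => ?_)⟩⟩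
  · exact (Category.id_comp h).trans (Category.comp_id h).symm
  · have h₁ : s.inl.left ≫ s.pt.hom = 𝟙 A ≫ s.inl.right := Arrow.w s.inl
    have h₂ : 𝟙 A ≫ s.inl.right = h ≫ s.inr.right :=
      congr_arg CommaMorphism.right s.condition
    exact h₁.trans h₂
  · have h₂ : 𝟙 A ≫ s.inl.right = h ≫ s.inr.right :=
      congr_arg CommaMorphism.right s.condition
    exact Arrow.hom_ext _ _ (Category.id_comp _) (h₂.symm.trans (Category.id_comp _))
  · exact Arrow.hom_ext _ _ (initialIsInitial.hom_ext _ _) (Category.id_comp _)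
  · refine Arrow.hom_ext _ _ ?_ ?_
    · exact (Category.id_comp _).symm.trans (congr_arg CommaMorphism.left h₁)
    · exact (Category.id_comp _).symm.trans (congr_arg CommaMorphism.right h₂)

lemma isCardinalPresentable_arrow {A B : M} (h : A ⟶ B) (hA : IsCardinalPresentable A κ)
    (hB : IsCardinalPresentable B κ) : IsCardinalPresentable (Arrow.mk h) κ :=
  isCardinalPresentable_of_isPushout (isPushout_arrow h) κ
    (isCardinalPresentable_initialArrow κ A hA) (isCardinalPresentable_idArrow κ A hA)
    (isCardinalPresentable_initialArrow κ B hB)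

/-- The identity arrows and the arrows from the initial object on the objects satisfying a
given property. -/
noncomputable def arrowGenerators (P : ObjectProperty M) : ObjectProperty (Arrow M) :=
  ObjectProperty.ofObj (Sum.elim (fun G : Subtype P => (idArrow M).obj G.1)
    (fun G : Subtype P => (initialArrow M).obj G.1))

lemma isStrongGenerator_arrowGenerators {P : ObjectProperty M} (hP : P.IsStrongGenerator) :
    (arrowGenerators P).IsStrongGenerator := by
  have hl (G : M) (hG : P G) : arrowGenerators P ((idArrow M).obj G) :=
    ObjectProperty.ofObj_apply (Sum.elim (fun G : Subtype P => (idArrow M).obj G.1)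
      (fun G : Subtype P => (initialArrow M).obj G.1)) (Sum.inl ⟨G, hG⟩)
  have hr (G : M) (hG : P G) : arrowGenerators P ((initialArrow M).obj G) :=
    ObjectProperty.ofObj_apply (Sum.elim (fun G : Subtype P => (idArrow M).obj G.1)
      (fun G : Subtype P => (initialArrow M).obj G.1)) (Sum.inr ⟨G, hG⟩)
  rw [ObjectProperty.isStrongGenerator_iff] at hP ⊢
  obtain ⟨h₁, h₂⟩ := hP
  refine ⟨fun X Y f g h => ?_, fun X Y i _ h => ?_⟩
  · refine Arrow.hom_ext _ _ (h₁ _ _ fun G hG a => ?_) (h₁ _ _ fun G hG a => ?_)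
    · exact congr_arg CommaMorphism.left (h _ (hl G hG) (idArrowHom a))
    · exact congr_arg CommaMorphism.right
        (h _ (hr G hG) (initialArrowHom a))
  · have := (idArrowAdj M).isRightAdjoint
    have := (initialArrowAdj M).isRightAdjoint
    have : Mono i.left := inferInstanceAs (Mono (Arrow.leftFunc.map i))
    have : Mono i.right := inferInstanceAs (Mono (Arrow.rightFunc.map i))
    have : IsIso i.left := h₂ _ fun G hG b => by
      obtain ⟨a, ha⟩ := h _ (hl G hG) (idArrowHom b)
      exact ⟨a.left, congr_arg CommaMorphism.left ha⟩
    have : IsIso i.right := h₂ _ fun G hG b => by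
      obtain ⟨a, ha⟩ := h _ (hr G hG) (initialArrowHom b)
      exact ⟨a.right, congr_arg CommaMorphism.right ha⟩
    exact Arrow.isIso_of_isIso_left_of_isIso_right _

end

section

variable (M : Type u) [Category.{v} M] (κ : Cardinal.{v}) [Fact κ.IsRegular]
  [IsCardinalLocallyPresentable M κ]

lemma exists_arrow_generator : ∃ (P : ObjectProperty (Arrow M)) (_ : ObjectProperty.Small.{v} P),
    P.IsStrongGenerator ∧ P ≤ isCardinalPresentable (Arrow M) κ ∧
      ∀ a, P a → IsCardinalPresentable a.left κ ∧ IsCardinalPresentable a.right κ := by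
  obtain ⟨P, _, hP, hP'⟩ :=
    (IsCardinalLocallyPresentable.iff_exists_isStrongGenerator M κ).1 inferInstance
  refine ⟨arrowGenerators P, ?_, isStrongGenerator_arrowGenerators hP, ?_, ?_⟩
  · dsimp only [arrowGenerators]
    have : Small.{v} (Subtype P) := ‹ObjectProperty.Small.{v} P›
    infer_instance
  · rintro _ ⟨G | G⟩
    · exact isCardinalPresentable_idArrow κ G.1 (hP' _ G.2)
    · exact isCardinalPresentable_initialArrow κ G.1 (hP' _ G.2)
  · rintro _ ⟨G | G⟩
    · exact ⟨hP' _ G.2, hP' _ G.2⟩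
    · refine ⟨?_, hP' _ G.2⟩
      have (k : Discrete PEmpty.{1}) : IsCardinalPresentable ((Functor.empty M).obj k) κ :=
        k.as.elim
      exact isCardinalPresentable_of_isColimit _ (initialIsInitial (C := M)) κ
        (hasCardinalLT_of_finite _ _ (Cardinal.IsRegular.aleph0_le Fact.out))

instance isCardinalLocallyPresentable_arrow : IsCardinalLocallyPresentable (Arrow M) κ := by
  obtain ⟨P, h, hP, hP', -⟩ := exists_arrow_generator M κ
  exact (IsCardinalLocallyPresentable.iff_exists_isStrongGenerator (Arrow M) κ).2 ⟨P, h, hP, hP'⟩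

variable {M}

lemma isCardinalPresentable_left_right (a : Arrow M) (ha : IsCardinalPresentable a κ) :
    IsCardinalPresentable a.left κ ∧ IsCardinalPresentable a.right κ := by
  obtain ⟨P, h, hP, hP', hP''⟩ := exists_arrow_generator M κ
  have ha' : isCardinalPresentable (Arrow M) κ a := ha
  rw [IsStrongGenerator.colimitsCardinalClosure_eq_isCardinalPresentable hP hP'] at ha'
  let Q : ObjectProperty (Arrow M) :=
    fun a => IsCardinalPresentable a.left κ ∧ IsCardinalPresentable a.right κ
  have : Q.IsClosedUnderIsomorphisms :=
    ⟨fun e h => ⟨by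
      have : IsCardinalPresentable (Arrow.leftFunc.obj _) κ := h.1
      exact isCardinalPresentable_of_iso (Arrow.leftFunc.mapIso e) κ, by
      have : IsCardinalPresentable (Arrow.rightFunc.obj _) κ := h.2
      exact isCardinalPresentable_of_iso (Arrow.rightFunc.mapIso e) κ⟩⟩
  refine ObjectProperty.colimitsCardinalClosure_le P κ (Q := Q) (fun J _ hJ => ?_) hP'' a ha'
  constructor
  rintro X ⟨p⟩
  constructor
  · have (j : J) : IsCardinalPresentable ((p.diag ⋙ Arrow.leftFunc).obj j) κ :=
      (p.prop_diag_obj j).1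
    exact isCardinalPresentable_of_isColimit _ (isColimitOfPreserves Arrow.leftFunc p.isColimit)
      κ hJ
  · have (j : J) : IsCardinalPresentable ((p.diag ⋙ Arrow.rightFunc).obj j) κ :=
      (p.prop_diag_obj j).2
    exact isCardinalPresentable_of_isColimit _ (isColimitOfPreserves Arrow.rightFunc p.isColimit)
      κ hJ

end

lemma isCardinalFiltered_of_fullyFaithful {C : Type*} {D : Type*} [Category* C] [Category* D]
    (F : C ⥤ D) [F.Full] [F.Faithful] (κ : Cardinal.{w}) [Fact κ.IsRegular]
    [IsCardinalFiltered D κ] (h : ∀ d, ∃ c, Nonempty (d ⟶ F.obj c)) : IsCardinalFiltered C κ := by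
  refine ⟨fun {A} _ G hA => ?_⟩
  let s := IsCardinalFiltered.cocone (G ⋙ F) hA
  obtain ⟨c, ⟨f⟩⟩ := h s.pt
  exact ⟨⟨c, { app := fun a => F.preimage (s.ι.app a ≫ f)
               naturality := fun a b φ => F.map_injective (by
                have := s.w φ
                simp only [Functor.comp_map] at this
                simp [reassoc_of% this]) }⟩⟩

lemma nonempty_filteredColimitPresentation {C : Type u} [Category.{v} C] (κ : Cardinal.{v})
    [Fact κ.IsRegular] [IsCardinalAccessibleCategory C κ] (P : ObjectProperty C)
    (hP : P ≤ isCardinalPresentable C κ) (X : C)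
    (hfac : ∀ {Z : C} (g : Z ⟶ X), IsCardinalPresentable Z κ →
      ∃ (Y : C) (u : Z ⟶ Y) (v : Y ⟶ X), u ≫ v = g ∧ P Y) :
    Nonempty (PaperAcc.FilteredColimitPresentation κ {Y | P Y} X) := by
  let incl : P.FullSubcategory ⥤ (isCardinalPresentable C κ).FullSubcategory :=
    ObjectProperty.ιOfLE hP
  have H (d : CostructuredArrow (isCardinalPresentable C κ).ι X) : ∃ c,
      Nonempty (d ⟶ (CostructuredArrow.pre incl (isCardinalPresentable C κ).ι X).obj c) := by
    obtain ⟨Y, u, v, huv, hY⟩ := hfac d.hom d.left.2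
    exact ⟨CostructuredArrow.mk (Y := ObjectProperty.FullSubcategory.mk _ hY) v,
      ⟨CostructuredArrow.homMk ⟨u⟩ huv⟩⟩
  have : IsFiltered (CostructuredArrow (isCardinalPresentable C κ).ι X) :=
    isFiltered_of_isCardinalFiltered _ κ
  have : (CostructuredArrow.pre incl (isCardinalPresentable C κ).ι X).Final :=
    Functor.final_of_exists_of_isFiltered_of_fullyFaithful (C := CostructuredArrow (incl ⋙ _) X)
      (CostructuredArrow.pre incl (isCardinalPresentable C κ).ι X) H
  have : IsCardinalFiltered (CostructuredArrow P.ι X) κ :=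
    isCardinalFiltered_of_fullyFaithful (C := CostructuredArrow (incl ⋙ _) X)
      (CostructuredArrow.pre incl (isCardinalPresentable C κ).ι X) κ H
  obtain ⟨hc⟩ : P.ι.isDenseAt X :=
    Functor.IsDenseAt.of_final (F := (isCardinalPresentable C κ).ι) incl
      (Functor.IsDense.isDenseAt _ _)
  have : EssentiallySmall.{v} (CostructuredArrow P.ι X) :=
    essentiallySmall_of_fully_faithful (C := CostructuredArrow (incl ⋙ _) X)
      (CostructuredArrow.pre incl (isCardinalPresentable C κ).ι X)
  let e := equivSmallModel.{v} (CostructuredArrow P.ι X)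
  have := IsCardinalFiltered.of_equivalence κ e
  exact ⟨{
    J := SmallModel.{v} (CostructuredArrow P.ι X)
    filtered := (isCardinalFiltered_iff_paper _ κ).2 inferInstance
    F := e.inverse ⋙ CostructuredArrow.proj P.ι X ⋙ P.ι
    mem := fun j => (e.inverse.obj j).left.2
    c := _
    isColimit := hc.whiskerEquivalence e.symm
    iso := Iso.refl _ }⟩

lemma exists_hom_to_generator {M : Type u} [Category.{v} M] (κ : Cardinal.{v})
    [Fact κ.IsRegular] {A : Set M} {X : M} (p : PaperAcc.FilteredColimitPresentation κ A X)
    {Z : M} (hZ : IsCardinalPresentable Z κ) (f : Z ⟶ X) :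
    ∃ (Y : M) (_ : Y ∈ A) (u : Z ⟶ Y) (v : Y ⟶ X), u ≫ v = f := by
  let := p.instJ
  have := (isCardinalFiltered_iff_paper _ κ).1 p.filtered
  obtain ⟨j, g, hg⟩ := IsCardinalPresentable.exists_hom_of_isColimit κ p.isColimit (f ≫ p.iso.inv)
  exact ⟨p.F.obj j, p.mem j, g, p.c.ι.app j ≫ p.iso.hom, by
    rw [reassoc_of% hg, Iso.inv_hom_id, Category.comp_id]⟩

end PaperAccAux

namespace PaperAcc

/-- Main Theorem, Theorem 4.2 / Theorem A.
Let `M` be a `κ`-combinatorial model category satisfying: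
(i) there is a set `A` of `κ`-presentable cofibrant objects such that every object of `M`
is a `κ`-filtered colimit of objects in `A`;
(ii) every (`κ`-presentable cofibrant) object in `A` has a cylinder object which is again
`κ`-presentable;
(iii) whenever a composite `i' = i ≫ q` is a cofibration between cofibrant objects, `i` is a
formal cofibration.
Then the full subcategory `W` of `M^→` spanned by the weak equivalences is `κ`-accessible:
it is closed under `κ`-filtered colimits in `M^→` and every weak equivalence is a `κ`-filtered
colimit in `M^→` of weak equivalences between `κ`-presentable objects. -/
theorem statement0 {M : Type u} [Category.{v} M] (κ : Cardinal.{v})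
    (S : ModelStructure M) (hcomb : IsCombinatorial S κ)
    -- (i)
    (A : Set M)
    (hA₁ : ∀ X ∈ A, IsPresentable κ X ∧ Cofibrant S X)
    (hA₂ : ∀ X : M, Nonempty (FilteredColimitPresentation κ A X))
    -- (ii)
    (hcyl : ∀ X ∈ A, ∃ cyl : CylinderObject S X, IsPresentable κ cyl.C)
    -- (iii)
    (hformal : ∀ {P Q R : M} (i : P ⟶ Q) (q : Q ⟶ R), S.Cof (i ≫ q) →
      Cofibrant S P → Cofibrant S R → IsFormalCofibration S i) :
    ClosedUnderFilteredColimits κ {a : Arrow M | S.W a.hom} ∧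
    ∀ {X Y : M} (f : X ⟶ Y), S.W f →
      Nonempty (FilteredColimitPresentation (M := Arrow M) κ
        (PresentableArrowsIn κ {a : Arrow M | S.W a.hom}) (Arrow.mk f)) := by
  have : Fact κ.IsRegular := ⟨hcomb.isRegular⟩
  have := PaperAccAux.isCardinalLocallyPresentable_of_paper κ hcomb.locallyPresentable
  refine ⟨PaperAccAux.closedUnderFilteredColimits_weakEquivalences S κ hcomb.cofGenerated
    hcomb.trivCofGenerated, fun {X Y} f hf => ?_⟩
  let P : ObjectProperty (Arrow M) := fun a =>
    a ∈ PresentableArrowsIn κ {a : Arrow M | S.W a.hom}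
  refine PaperAccAux.nonempty_filteredColimitPresentation κ P (fun a ha => ?_) (Arrow.mk f)
    (fun {Z} φ hZ => ?_)
  · exact PaperAccAux.isCardinalPresentable_arrow κ a.hom
      ((PaperAccAux.isPresentable_iff κ _).1 ha.2.1) ((PaperAccAux.isPresentable_iff κ _).1 ha.2.2)
  · obtain ⟨hZl, hZr⟩ := PaperAccAux.isCardinalPresentable_left_right κ Z hZ
    have hφ : φ.left ≫ f = Z.hom ≫ φ.right := Arrow.w φ
    obtain ⟨A₀, hA₀, a₀, a, ha⟩ := PaperAccAux.exists_hom_to_generator κ (hA₂ X).some hZl φ.left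
    have hA₀' := (PaperAccAux.isPresentable_iff κ _).1 (hA₁ _ hA₀).1
    have po := IsPushout.of_hasPushout Z.hom a₀
    have hw : Z.hom ≫ φ.right = a₀ ≫ a ≫ f := by rw [reassoc_of% ha, hφ]
    obtain ⟨B₀, hB₀, b₀, b, hb⟩ := PaperAccAux.exists_hom_to_generator κ (hA₂ Y).some
      (PaperAccAux.isCardinalPresentable_of_isPushout po κ hZl hZr hA₀')
      (po.desc φ.right (a ≫ f) hw)
    obtain ⟨cyl, hcyl'⟩ := hcyl A₀ hA₀
    obtain ⟨A', B', g', a₁, a₂, b₁, b₂, hA', hB', hg', e₁, e₂, e₃, e₄⟩ :=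
      PaperAccAux.exists_presentable_weakEquivalence_factor κ hcomb.cofGenerated
        hcomb.trivCofGenerated hformal (hA₁ _ hA₀).2 (hA₁ _ hB₀).2 hA₀'
        ((PaperAccAux.isPresentable_iff κ _).1 (hA₁ _ hB₀).1) cyl
        ((PaperAccAux.isPresentable_iff κ _).1 hcyl') (pushout.inr Z.hom a₀ ≫ b₀) f hf a b
        (by rw [Category.assoc, hb, po.inr_desc])
    refine ⟨Arrow.mk g', Arrow.homMk (a₀ ≫ a₁) (pushout.inl Z.hom a₀ ≫ b₀ ≫ b₁) ?_,
      Arrow.homMk a₂ b₂ e₄.symm, Arrow.hom_ext _ _ ?_ ?_, hg',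
      (PaperAccAux.isPresentable_iff κ _).2 hA', (PaperAccAux.isPresentable_iff κ _).2 hB'⟩
    · have h : (a₀ ≫ a₁) ≫ g' = Z.hom ≫ pushout.inl Z.hom a₀ ≫ b₀ ≫ b₁ := by
        rw [Category.assoc, e₃, Category.assoc, po.w_assoc]
      exact h
    · have h : (a₀ ≫ a₁) ≫ a₂ = φ.left := by rw [Category.assoc, e₁, ha]
      exact h
    · have h : (pushout.inl Z.hom a₀ ≫ b₀ ≫ b₁) ≫ b₂ = φ.right := by
        rw [Category.assoc, Category.assoc, e₂, hb, po.inl_desc]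
      exact h

end PaperAcc
end

section
/- Let K be a κ-combinatorial category (κ a regular cardinal). Then every cofibration in K is a κ-directed colimit, taken in the arrow category K^→, of cofibrations between κ-presentable objects. -/
open CategoryTheory CategoryTheory.Limits

universe w v u

namespace CombinatorialCategory

section Approximation

variable {C : Type u} [Category.{v} C] (κ : Cardinal.{v}) [Fact κ.IsRegular]

/-- Every morphism from a `κ`-presentable object to `X` factors through an object of `T`. -/
def IsApproximable (T : ObjectProperty C) : ObjectProperty C := fun X ↦
  ∀ ⦃G : C⦄ (_ : IsCardinalPresentable G κ) (g : G ⟶ X),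
    ∃ (A : C) (_ : T A) (a : G ⟶ A) (b : A ⟶ X), a ≫ b = g

variable {κ} {T : ObjectProperty C}

lemma isApproximable_of_prop {X : C} (hX : T X) : IsApproximable κ T X :=
  fun _ _ g ↦ ⟨X, hX, g, 𝟙 X, by simp⟩

lemma IsApproximable.of_retract {X Y : C} (hY : IsApproximable κ T Y) (r : Retract X Y) :
    IsApproximable κ T X := by
  intro G hG g
  obtain ⟨A, hA, a, b, fac⟩ := hY hG (g ≫ r.i)
  exact ⟨A, hA, a, b ≫ r.r, by simp [reassoc_of% fac]⟩

lemma IsApproximable.of_isColimit {J : Type*} [Category* J] [EssentiallySmall.{v} J]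
    [IsCardinalFiltered J κ]
    {F : J ⥤ C} {c : Cocone F} (hc : IsColimit c) (hF : ∀ j, IsApproximable κ T (F.obj j)) :
    IsApproximable κ T c.pt := by
  intro G hG g
  obtain ⟨j, x, hx⟩ := IsCardinalPresentable.exists_hom_of_isColimit κ hc g
  obtain ⟨A, hA, a, b, fac⟩ := hF j hG x
  exact ⟨A, hA, a, b ≫ c.ι.app j, by rw [reassoc_of% fac, hx]⟩

lemma isCardinalFiltered_of_fullyFaithful {D : Type*} [Category* D] {E : Type*} [Category* E]
    (F : D ⥤ E) [F.Full] [F.Faithful] [IsCardinalFiltered E κ]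
    (h : ∀ e, ∃ d, Nonempty (e ⟶ F.obj d)) : IsCardinalFiltered D κ where
  nonempty_cocone {A} _ G hA := by
    let c := IsCardinalFiltered.cocone (G ⋙ F) hA
    obtain ⟨d, ⟨x⟩⟩ := h c.pt
    exact ⟨{
      pt := d
      ι := { app := fun a ↦ F.preimage (c.ι.app a ≫ x)
             naturality := fun a b f ↦ F.map_injective (by
              have := c.w f
              dsimp at this
              simp [reassoc_of% this]) } }⟩

lemma IsApproximable.exists_colimitOfShape [IsCardinalLocallyPresentable C κ]
    (hT : T ≤ isCardinalPresentable C κ) {X : C} (hX : IsApproximable κ T X) :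
    ∃ (J : Type v) (_ : PartialOrder J) (_ : IsCardinalFiltered J κ),
      Nonempty (T.ColimitOfShape J X) := by
  let Q := isCardinalPresentable C κ
  let incl : T.FullSubcategory ⥤ Q.FullSubcategory := ObjectProperty.ιOfLE hT
  have H (d : CostructuredArrow Q.ι X) : ∃ c,
      Nonempty (d ⟶ (CostructuredArrow.pre incl Q.ι X).obj c) := by
    obtain ⟨W, hW, u, v, huv⟩ := hX d.left.2 d.hom
    exact ⟨CostructuredArrow.mk (Y := ObjectProperty.FullSubcategory.mk _ hW) v,
      ⟨CostructuredArrow.homMk ⟨u⟩ huv⟩⟩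
  have := isFiltered_of_isCardinalFiltered (CostructuredArrow Q.ι X) κ
  have : (CostructuredArrow.pre incl Q.ι X).Final :=
    Functor.final_of_exists_of_isFiltered_of_fullyFaithful (C := CostructuredArrow (incl ⋙ _) X)
      (CostructuredArrow.pre incl Q.ι X) H
  have : IsCardinalFiltered (CostructuredArrow T.ι X) κ :=
    isCardinalFiltered_of_fullyFaithful (D := CostructuredArrow (incl ⋙ _) X)
      (CostructuredArrow.pre incl Q.ι X) H
  obtain ⟨hc⟩ : T.ι.isDenseAt X :=
    Functor.IsDenseAt.of_final (F := Q.ι) incl (Functor.IsDense.isDenseAt _ _)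
  have : EssentiallySmall.{v} (CostructuredArrow T.ι X) :=
    essentiallySmall_of_fully_faithful (C := CostructuredArrow (incl ⋙ _) X)
      (CostructuredArrow.pre incl Q.ι X)
  let e := equivSmallModel.{v} (CostructuredArrow T.ι X)
  have : IsCardinalFiltered (SmallModel.{v} (CostructuredArrow T.ι X)) κ :=
    IsCardinalFiltered.of_equivalence κ e
  obtain ⟨α, _, _, F, _⟩ := IsCardinalFiltered.exists_cardinal_directed
    (SmallModel.{v} (CostructuredArrow T.ι X)) κ
  let p : T.ColimitOfShape (CostructuredArrow T.ι X) X :=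
    { diag := _, ι := _, isColimit := hc, prop_diag_obj := fun j ↦ j.left.2 }
  exact ⟨α, inferInstance, inferInstance, ⟨p.reindex (F ⋙ e.inverse)⟩⟩

end Approximation

section ArrowPresentable

variable {C : Type u} [Category.{v} C] (κ : Cardinal.{v}) [Fact κ.IsRegular]

/-- The arrows whose source and target are `κ`-presentable. -/
def arrowsBetweenPresentables : ObjectProperty (Arrow C) := fun g ↦
  IsCardinalPresentable g.left κ ∧ IsCardinalPresentable g.right κ

/-- A cocone in the arrow category is colimit if its source and target components are. -/
def isColimitArrow {J : Type*} [Category* J] {F : J ⥤ Arrow C} {c : Cocone F}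
    (h₁ : IsColimit (Arrow.leftFunc.mapCocone c)) (h₂ : IsColimit (Arrow.rightFunc.mapCocone c)) :
    IsColimit c :=
  Comma.fstSndJointlyReflectColimit h₁ h₂

section

variable [HasColimits C]

lemma isCardinalPresentable_arrow_id (A : C) [IsCardinalPresentable A κ] :
    IsCardinalPresentable (Arrow.mk (𝟙 A)) κ := by
  let e : Arrow.leftFunc ⋙ coyoneda.obj (Opposite.op A) ≅
      coyoneda.obj (Opposite.op (Arrow.mk (𝟙 A))) :=
    NatIso.ofComponents (fun f ↦ Equiv.toIso
      { toFun := fun (a : A ⟶ f.left) ↦ Arrow.homMk a (a ≫ f.hom)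
        invFun := fun φ ↦ φ.left
        left_inv := fun _ ↦ rfl
        right_inv := fun (φ : Arrow.mk (𝟙 A) ⟶ f) ↦ Arrow.hom_ext _ _ rfl
          ((Arrow.w φ).trans (Category.id_comp _)) })
      (fun {f g} φ ↦ by
        ext (a : A ⟶ f.left)
        refine Arrow.hom_ext _ _ rfl ?_
        change (a ≫ φ.left) ≫ g.hom = (a ≫ f.hom) ≫ φ.right
        simp)
  have : (Arrow.leftFunc (C := C)).IsCardinalAccessible κ := { }
  exact Functor.isCardinalAccessible_of_natIso e κ

lemma isCardinalPresentable_arrow_initial (A : C) [IsCardinalPresentable A κ] :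
    IsCardinalPresentable (Arrow.mk (initial.to A)) κ := by
  let e : Arrow.rightFunc ⋙ coyoneda.obj (Opposite.op A) ≅
      coyoneda.obj (Opposite.op (Arrow.mk (initial.to A))) :=
    NatIso.ofComponents (fun f ↦ Equiv.toIso
      { toFun := fun (a : A ⟶ f.right) ↦ Arrow.homMk (initial.to f.left) a
          (initialIsInitial.hom_ext _ _)
        invFun := fun φ ↦ φ.right
        left_inv := fun _ ↦ rfl
        right_inv := fun (φ : Arrow.mk (initial.to A) ⟶ f) ↦
          Arrow.hom_ext _ _ (initialIsInitial.hom_ext _ _) rfl })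
      (fun {f g} φ ↦ by
        ext (a : A ⟶ f.right)
        exact Arrow.hom_ext _ _ (initialIsInitial.hom_ext _ _) rfl)
  have : (Arrow.rightFunc (C := C)).IsCardinalAccessible κ := { }
  exact Functor.isCardinalAccessible_of_natIso e κ

/-- An arrow `A ⟶ B` is the pushout of `𝟙 A` and `⊥_ ⟶ B` along `⊥_ ⟶ A`. -/
lemma isPushout_arrow {A B : C} (g : A ⟶ B) :
    IsPushout (Arrow.homMk (initial.to A) (𝟙 A) (by simp) :
        Arrow.mk (initial.to A) ⟶ Arrow.mk (𝟙 A))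
      (Arrow.homMk (𝟙 _) g (initialIsInitial.hom_ext _ _) :
        Arrow.mk (initial.to A) ⟶ Arrow.mk (initial.to B))
      (Arrow.homMk (𝟙 A) g (by simp) : Arrow.mk (𝟙 A) ⟶ Arrow.mk g)
      (Arrow.homMk (initial.to A) (𝟙 B) (initialIsInitial.hom_ext _ _) :
        Arrow.mk (initial.to B) ⟶ Arrow.mk g) where
  w := by
    apply Arrow.hom_ext
    · exact initialIsInitial.hom_ext _ _
    · simp
  isColimit' := ⟨PushoutCocone.IsColimit.mk _
    (fun s ↦ Arrow.homMk s.inl.left s.inr.right (by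
      have h₁ := congr_arg Arrow.Hom.right s.condition
      have h₂ := Arrow.w s.inl
      change 𝟙 A ≫ s.inl.right = g ≫ s.inr.right at h₁
      change s.inl.left ≫ s.pt.hom = 𝟙 A ≫ s.inl.right at h₂
      exact h₂.trans h₁))
    (fun s ↦ by
      refine Arrow.hom_ext _ _ (Category.id_comp _) ?_
      have h₁ := congr_arg Arrow.Hom.right s.condition
      change 𝟙 A ≫ s.inl.right = g ≫ s.inr.right at h₁
      exact h₁.symm.trans (Category.id_comp _))
    (fun s ↦ by
      exact Arrow.hom_ext _ _ (initialIsInitial.hom_ext _ _) (Category.id_comp _))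
    (fun s m h₁ h₂ ↦ by
      exact Arrow.hom_ext _ _
        ((Category.id_comp _).symm.trans (congr_arg Arrow.Hom.left h₁))
        ((Category.id_comp _).symm.trans (congr_arg Arrow.Hom.right h₂)))⟩

lemma IsPushout.isCardinalPresentable {D : Type*} [Category.{v} D] {A B X Y : D}
    {f : A ⟶ B} {g : A ⟶ X} {h : B ⟶ Y} {k : X ⟶ Y} (sq : IsPushout f g h k)
    [IsCardinalPresentable A κ] [IsCardinalPresentable B κ] [IsCardinalPresentable X κ] :
    IsCardinalPresentable Y κ := by
  have : ∀ j, IsCardinalPresentable ((span f g).obj j) κ := by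
    rintro (_ | _ | _) <;> assumption
  exact isCardinalPresentable_of_isColimit' _ sq.isColimit κ
    (.of_le (by simp only [hasCardinalLT_aleph0_iff]; infer_instance)
      (Cardinal.IsRegular.aleph0_le Fact.out))

lemma isCardinalPresentable_arrow {g : Arrow C} (hg : arrowsBetweenPresentables κ g) :
    IsCardinalPresentable g κ := by
  have := hg.1
  have := hg.2
  have := isCardinalPresentable_arrow_id κ g.left
  have := isCardinalPresentable_arrow_initial κ g.left
  have := isCardinalPresentable_arrow_initial κ g.right
  exact IsPushout.isCardinalPresentable κ (isPushout_arrow g.hom)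

end

variable (C) in
lemma exists_isStrongGenerator_arrow [IsCardinalLocallyPresentable C κ] :
    ∃ (P : ObjectProperty (Arrow C)) (_ : ObjectProperty.Small.{v} P), P.IsStrongGenerator ∧
      P ≤ arrowsBetweenPresentables κ := by
  obtain ⟨P, _, hP, hP'⟩ := (IsCardinalLocallyPresentable.iff_exists_isStrongGenerator C κ).1
    inferInstance
  let obj : Subtype P ⊕ Subtype P → Arrow C :=
    Sum.elim (fun G ↦ Arrow.mk (𝟙 G.1)) (fun G ↦ Arrow.mk (initial.to G.1))
  refine ⟨ObjectProperty.ofObj obj, inferInstance, ?_, ?_⟩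
  · rw [ObjectProperty.isStrongGenerator_iff]
    refine ⟨fun f g α β h ↦ ?_, fun f g i _ hi ↦ ?_⟩
    · apply Arrow.hom_ext
      · refine hP.isSeparating _ _ (fun G hG a ↦ ?_)
        exact congr_arg Arrow.Hom.left (h _ (ObjectProperty.ofObj_apply obj (Sum.inl ⟨G, hG⟩))
          (Arrow.homMk (f := Arrow.mk (𝟙 G)) a (a ≫ f.hom) (by simp)))
      · refine hP.isSeparating _ _ (fun G hG a ↦ ?_)
        exact congr_arg Arrow.Hom.right (h _ (ObjectProperty.ofObj_apply obj (Sum.inr ⟨G, hG⟩))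
          (Arrow.homMk (f := Arrow.mk (initial.to G)) (initial.to _) a
            (initialIsInitial.hom_ext _ _)))
    · have : Mono i.left := ⟨fun {Z} a b hab ↦ by
        have : (Arrow.homMk a (a ≫ f.hom) (by simp) : Arrow.mk (𝟙 Z) ⟶ f) =
            Arrow.homMk b (b ≫ f.hom) (by simp) := by
          rw [← cancel_mono i]
          apply Arrow.hom_ext
          · exact hab
          · have hw := Arrow.w i
            change (a ≫ f.hom) ≫ i.right = (b ≫ f.hom) ≫ i.right
            rw [Category.assoc, Category.assoc, ← hw, reassoc_of% hab]
        exact congr_arg Arrow.Hom.left this⟩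
      have : Mono i.right := ⟨fun {Z} a b hab ↦ by
        have : (Arrow.homMk (initial.to _) a (initialIsInitial.hom_ext _ _) :
              Arrow.mk (initial.to Z) ⟶ f) =
            Arrow.homMk (initial.to _) b (initialIsInitial.hom_ext _ _) := by
          rw [← cancel_mono i]
          apply Arrow.hom_ext
          · exact initialIsInitial.hom_ext _ _
          · exact hab
        exact congr_arg Arrow.Hom.right this⟩
      have : IsIso i.left := hP.isIso_of_mono _ (fun G hG a ↦ by
        obtain ⟨b, hb⟩ := hi _ (ObjectProperty.ofObj_apply obj (Sum.inl ⟨G, hG⟩))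
          (Arrow.homMk (f := Arrow.mk (𝟙 G)) a (a ≫ g.hom) (by simp))
        exact ⟨b.left, congr_arg Arrow.Hom.left hb⟩)
      have : IsIso i.right := hP.isIso_of_mono _ (fun G hG a ↦ by
        obtain ⟨b, hb⟩ := hi _ (ObjectProperty.ofObj_apply obj (Sum.inr ⟨G, hG⟩))
          (Arrow.homMk (f := Arrow.mk (initial.to G)) (initial.to _) a
            (initialIsInitial.hom_ext _ _))
        exact ⟨b.right, congr_arg Arrow.Hom.right hb⟩)
      exact Arrow.isIso_of_isIso_left_of_isIso_right i
  · have (k : Discrete PEmpty.{1}) : IsCardinalPresentable ((Functor.empty C).obj k) κ := k.as.elim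
    have : IsCardinalPresentable (⊥_ C) κ :=
      isCardinalPresentable_of_isColimit' (asEmptyCocone (⊥_ C)) initialIsInitial κ
        (.of_le (by simp only [hasCardinalLT_aleph0_iff]; infer_instance)
          (Cardinal.IsRegular.aleph0_le Fact.out))
    rintro _ ⟨⟨G, hG⟩ | ⟨G, hG⟩⟩
    · exact ⟨hP' _ hG, hP' _ hG⟩
    · exact ⟨this, hP' _ hG⟩

instance isCardinalLocallyPresentable_arrow [IsCardinalLocallyPresentable C κ] :
    IsCardinalLocallyPresentable (Arrow C) κ := by
  obtain ⟨P, _, hP, hP'⟩ := exists_isStrongGenerator_arrow C κ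
  exact (IsCardinalLocallyPresentable.iff_exists_isStrongGenerator _ κ).2
    ⟨P, inferInstance, hP, fun g hg ↦ isCardinalPresentable_arrow κ (hP' _ hg)⟩

lemma arrowsBetweenPresentables_iff [IsCardinalLocallyPresentable C κ] {g : Arrow C} :
    arrowsBetweenPresentables κ g ↔ IsCardinalPresentable g κ := by
  refine ⟨fun hg ↦ isCardinalPresentable_arrow κ hg, fun hg ↦ ?_⟩
  obtain ⟨P, _, hP, hP'⟩ := exists_isStrongGenerator_arrow C κ
  rw [← isCardinalPresentable_iff,
    IsStrongGenerator.colimitsCardinalClosure_eq_isCardinalPresentable hP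
      (fun g hg ↦ isCardinalPresentable_arrow κ (hP' _ hg))] at hg
  have : (arrowsBetweenPresentables (C := C) κ).IsClosedUnderIsomorphisms :=
    ⟨fun {f g} e h ↦ ⟨(isCardinalPresentable C κ).prop_of_iso (Arrow.leftFunc.mapIso e) h.1,
      (isCardinalPresentable C κ).prop_of_iso (Arrow.rightFunc.mapIso e) h.2⟩⟩
  refine ObjectProperty.colimitsCardinalClosure_le _ κ (fun J _ hJ ↦ ?_) hP' _ hg
  have := isClosedUnderColimitsOfShape_isCardinalPresentable C hJ
  exact ⟨fun X ⟨p⟩ ↦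
    ⟨(isCardinalPresentable C κ).prop_of_isColimit
      (isColimitOfPreserves Arrow.leftFunc p.isColimit) (fun j ↦ (p.prop_diag_obj j).1),
    (isCardinalPresentable C κ).prop_of_isColimit
      (isColimitOfPreserves Arrow.rightFunc p.isColimit) (fun j ↦ (p.prop_diag_obj j).2)⟩⟩

end ArrowPresentable

section Cells

open SmallObject

variable {C : Type u} [Category.{v} C] {I : Type w} {A B : I → C} (f : ∀ i, A i ⟶ B i)
  [HasPushouts C]
  [∀ {X S : C} (πX : X ⟶ S), HasColimitsOfShape (Discrete (FunctorObjIndex f πX)) C]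

/-- The square with a member of the family `f` on the left, seen as a cell. -/
def cellIndex {g : Arrow C} {i : I} (σ : Arrow.mk (f i) ⟶ g) : FunctorObjIndex f g.hom :=
  ⟨i, σ.left, σ.right, Arrow.w σ⟩

/-- The cell of `functorObj f g.hom` attached along a square. -/
noncomputable def cell {g : Arrow C} {i : I} (σ : Arrow.mk (f i) ⟶ g) :
    B i ⟶ functorObj f g.hom :=
  Sigma.ι (functorObjTgtFamily f g.hom) (cellIndex f σ) ≫ ρFunctorObj f g.hom

lemma cell_comp {g : Arrow C} {i : I} (σ : Arrow.mk (f i) ⟶ g) {Z : C}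
    (a : functorObj f g.hom ⟶ Z) :
    cell f σ ≫ a =
      Sigma.ι (functorObjTgtFamily f g.hom) (cellIndex f σ) ≫ ρFunctorObj f g.hom ≫ a :=
  Category.assoc _ _ _

lemma comp_cell {g : Arrow C} {i : I} (σ : Arrow.mk (f i) ⟶ g) :
    f i ≫ cell f σ = σ.left ≫ ιFunctorObj f g.hom :=
  (cellIndex f σ).comm

lemma cell_functorMap {g g' : Arrow C} {i : I} (σ : Arrow.mk (f i) ⟶ g) (τ : g ⟶ g') :
    cell f σ ≫ functorMap f (πX := g.hom) (πY := g'.hom) τ = cell f (σ ≫ τ) := by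
  have h : ρFunctorObj f g.hom ≫ functorMap f (πX := g.hom) (πY := g'.hom) τ =
      functorMapTgt f (πX := g.hom) (πY := g'.hom) τ ≫ ρFunctorObj f g'.hom :=
    pushout.inr_desc _ _ _
  rw [cell_comp, h]
  exact (ι_functorMapTgt_assoc f (πX := g.hom) (πY := g'.hom) τ i σ.left σ.right (Arrow.w σ) _
    rfl _ rfl _)

lemma functorObj_hom_ext {g : Arrow C} {Z : C} {a b : functorObj f g.hom ⟶ Z}
    (h₁ : ιFunctorObj f g.hom ≫ a = ιFunctorObj f g.hom ≫ b)
    (h₂ : ∀ (i : I) (σ : Arrow.mk (f i) ⟶ g), cell f σ ≫ a = cell f σ ≫ b) : a = b := by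
  apply pushout.hom_ext h₁
  refine Sigma.hom_ext _ _ (fun x ↦ ?_)
  have := h₂ x.i (Arrow.homMk (f := Arrow.mk (f x.i)) x.t x.b x.w)
  rw [cell_comp, cell_comp] at this
  exact this

lemma exists_functorObj_desc {g : Arrow C} {Z : C} (a : g.left ⟶ Z)
    (b : ∀ (i : I), (Arrow.mk (f i) ⟶ g) → (B i ⟶ Z))
    (h : ∀ i σ, f i ≫ b i σ = σ.left ≫ a) :
    ∃ (d : functorObj f g.hom ⟶ Z), ιFunctorObj f g.hom ≫ d = a ∧
      ∀ i (σ : Arrow.mk (f i) ⟶ g), cell f σ ≫ d = b i σ := by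
  let b' : ∐ functorObjTgtFamily f g.hom ⟶ Z := Sigma.desc (fun x ↦
    b x.i (Arrow.homMk (f := Arrow.mk (f x.i)) x.t x.b x.w))
  have hb' (x) : Sigma.ι (functorObjTgtFamily f g.hom) x ≫ b' =
      b x.i (Arrow.homMk (f := Arrow.mk (f x.i)) x.t x.b x.w) :=
    colimit.ι_desc _ _
  have fac : functorObjTop f g.hom ≫ a = functorObjLeft f g.hom ≫ b' := by
    refine Sigma.hom_ext _ _ (fun x ↦ ?_)
    have h₁ : Sigma.ι (functorObjSrcFamily f g.hom) x ≫ functorObjTop f g.hom = x.t :=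
      colimit.ι_desc _ _
    have h₂ : Sigma.ι (functorObjSrcFamily f g.hom) x ≫ functorObjLeft f g.hom =
      f x.i ≫ Sigma.ι (functorObjTgtFamily f g.hom) x := Sigma.ι_map _ _
    rw [reassoc_of% h₁, reassoc_of% h₂, hb', h]
    rfl
  refine ⟨pushout.desc a b' fac, pushout.inl_desc _ _ _, fun i σ ↦ ?_⟩
  have h₃ : ρFunctorObj f g.hom ≫ pushout.desc a b' fac = b' := pushout.inr_desc _ _ _
  rw [cell_comp, h₃, hb']
  rfl

variable (κ : Cardinal.{v}) [Fact κ.IsRegular] [HasColimits C]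

/-- One step of the small object argument commutes with `κ`-filtered colimits when the
morphisms in the family are `κ`-presentable as arrows. -/
lemma isCardinalAccessible_functor (hf : ∀ i, IsCardinalPresentable (Arrow.mk (f i)) κ) :
    (SmallObject.functor f).IsCardinalAccessible κ where
  preservesColimitOfShape J _ _ := ⟨fun {F} ↦ ⟨fun {c} hc ↦ by
    have hl : IsColimit (Arrow.leftFunc.mapCocone c) := isColimitOfPreserves _ hc
    have hr : IsColimit (Arrow.rightFunc.mapCocone c) := isColimitOfPreserves _ hc
    let mp {g g' : Arrow C} (τ : g ⟶ g') : functorObj f g.hom ⟶ functorObj f g'.hom :=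
      functorMap f (πX := g.hom) (πY := g'.hom) τ
    have hmp {g g' : Arrow C} (τ : g ⟶ g') :
      ιFunctorObj f g.hom ≫ mp τ = τ.left ≫ ιFunctorObj f g'.hom := ιFunctorObj_naturality f τ
    let mpc (j : J) : functorObj f (F.obj j).hom ⟶ functorObj f c.pt.hom := mp (c.ι.app j)
    have hmpc (j : J) : ιFunctorObj f (F.obj j).hom ≫ mpc j =
      (c.ι.app j).left ≫ ιFunctorObj f c.pt.hom := hmp (c.ι.app j)
    have hex (i : I) (σ : Arrow.mk (f i) ⟶ c.pt) :
        ∃ (j : J) (y : Arrow.mk (f i) ⟶ F.obj j), y ≫ c.ι.app j = σ :=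
      IsCardinalPresentable.exists_hom_of_isColimit κ hc σ
    refine ⟨isColimitArrow ?_ hr⟩
    have key (s : Cocone ((F ⋙ SmallObject.functor f) ⋙ Arrow.leftFunc)) :
        ∃ (d : functorObj f c.pt.hom ⟶ s.pt), ∀ j, mpc j ≫ d = s.ι.app j := by
      let s' (j : J) : functorObj f (F.obj j).hom ⟶ s.pt := s.ι.app j
      have hs' {j j' : J} (φ : j ⟶ j') : mp (F.map φ) ≫ s' j' = s' j := s.w φ
      let t : Cocone (F ⋙ Arrow.leftFunc) :=
        { pt := s.pt
          ι := { app := fun j ↦ ιFunctorObj f (F.obj j).hom ≫ s' j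
                 naturality := fun j j' φ ↦ by
                  change (F.map φ).left ≫ ιFunctorObj f (F.obj j').hom ≫ s' j' =
                    (ιFunctorObj f (F.obj j).hom ≫ s' j) ≫ 𝟙 _
                  rw [← reassoc_of% (hmp (F.map φ)), hs', Category.comp_id] } }
      let a : c.pt.left ⟶ s.pt := hl.desc t
      have ha (j : J) : (c.ι.app j).left ≫ a = ιFunctorObj f (F.obj j).hom ≫ s' j :=
        hl.fac t j
      choose j y hy using hex
      have indep (i : I) {j₁ j₂ : J} (y₁ : Arrow.mk (f i) ⟶ F.obj j₁)
          (y₂ : Arrow.mk (f i) ⟶ F.obj j₂) (h : y₁ ≫ c.ι.app j₁ = y₂ ≫ c.ι.app j₂) :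
          cell f y₁ ≫ s' j₁ = cell f y₂ ≫ s' j₂ := by
        obtain ⟨k, u₁, u₂, hu⟩ := IsCardinalPresentable.exists_eq_of_isColimit κ hc y₁ y₂ h
        rw [← hs' u₁, ← hs' u₂, ← Category.assoc, ← Category.assoc, cell_functorMap,
          cell_functorMap, hu]
      obtain ⟨d, hd₁, hd₂⟩ := exists_functorObj_desc f a
        (fun i σ ↦ cell f (y i σ) ≫ s' (j i σ)) (fun i σ ↦ by
          rw [← Category.assoc, comp_cell, Category.assoc, ← ha, ← Category.assoc,
            ← Arrow.comp_left, hy])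
      refine ⟨d, fun j ↦ functorObj_hom_ext f ?_ (fun i σ ↦ ?_)⟩
      · rw [reassoc_of% (hmpc j), hd₁, ha]
      · rw [← Category.assoc, cell_functorMap, hd₂]
        exact indep i _ _ (hy _ _)
    choose d hd using key
    have ext {Z : C} (m m' : functorObj f c.pt.hom ⟶ Z) (h : ∀ j, mpc j ≫ m = mpc j ≫ m') :
        m = m' := by
      refine functorObj_hom_ext (g := c.pt) f (hl.hom_ext (fun j ↦ ?_)) (fun i σ ↦ ?_)
      · change (c.ι.app j).left ≫ ιFunctorObj f c.pt.hom ≫ m =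
          (c.ι.app j).left ≫ ιFunctorObj f c.pt.hom ≫ m'
        rw [← reassoc_of% (hmpc j), ← reassoc_of% (hmpc j), h]
      · obtain ⟨j, y, rfl⟩ := hex i σ
        have hy : cell f (y ≫ c.ι.app j) = cell f y ≫ mpc j := (cell_functorMap f y _).symm
        exact (congr_arg (· ≫ m) hy).trans ((Category.assoc _ _ _).trans
          ((congr_arg (cell f y ≫ ·) (h j)).trans ((Category.assoc _ _ _).symm.trans
            (congr_arg (· ≫ m') hy.symm))))
    exact
      { desc := d
        fac := hd
        uniq := fun s m hm ↦ ext _ _ (fun j ↦ (hm j).trans (hd s j).symm) }⟩⟩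

end Cells

section Iteration

open SmallObject

variable {C : Type u} [Category.{v} C] (κ : Cardinal.{v}) [Fact κ.IsRegular]

lemma isCardinalAccessible_of_isColimit {D : Type*} [Category* D] {E : Type*} [Category* E]
    {K : Type*} [Category* K] [HasColimitsOfShape K E] {G : K ⥤ D ⥤ E} {c : Cocone G}
    (hc : IsColimit c) (hG : ∀ k, (G.obj k).IsCardinalAccessible κ) :
    c.pt.IsCardinalAccessible κ where
  preservesColimitOfShape J _ _ := by
    have (k : K) : PreservesColimitsOfShape J (G.obj k) :=
      (G.obj k).preservesColimitsOfShape_of_isCardinalAccessible κ J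
    have : PreservesColimitsOfShape J G.flip := ⟨fun {F} ↦ ⟨fun {s} hs ↦
      ⟨evaluationJointlyReflectsColimits _ (fun k ↦ isColimitOfPreserves (G.obj k) hs)⟩⟩⟩
    exact preservesColimitsOfShape_of_natIso ((colimitIsoFlipCompColim G).symm ≪≫
      (colimit.isColimit G).coconePointUniqueUpToIso hc)

variable (I : MorphismProperty C) [OrderBot κ.ord.ToType]

lemma isCardinalForSmallObjectArgument [HasColimits C] [MorphismProperty.IsSmall.{v} I]
    (hI : ∀ {A B : C} (i : A ⟶ B), I i → IsCardinalPresentable A κ) :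
    I.IsCardinalForSmallObjectArgument κ where
  preservesColimit {A _ _ _} i hi _ _ := by
    have := hI i hi
    have := preservesColimitsOfShape_of_isCardinalPresentable A κ κ.ord.ToType
    infer_instance

lemma isCardinalAccessible_iterationFunctor_obj [HasColimits C]
    [I.IsCardinalForSmallObjectArgument κ]
    (hI : ∀ {A B : C} (i : A ⟶ B), I i → IsCardinalPresentable (Arrow.mk i) κ)
    (j : κ.ord.ToType) : ((iterationFunctor I κ).obj j).IsCardinalAccessible κ := by
  have := hasIterationOfShape I κ
  have := hasColimitsOfShape_discrete I κ
  have := Cardinal.noMaxOrder (Fact.elim inferInstance : κ.IsRegular).aleph0_le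
  have hstep := isCardinalAccessible_functor I.homFamily κ (fun i ↦ hI _ i.2)
  induction j using SuccOrder.limitRecOn with
  | isMin j hj =>
    obtain rfl := hj.eq_bot
    exact Functor.isCardinalAccessible_of_natIso (F := 𝟭 (Arrow C))
      ((succStruct I κ).iterationFunctorObjBotIso κ.ord.ToType).symm κ
  | succ j hj hj' =>
    exact Functor.isCardinalAccessible_of_natIso
      (F := (iterationFunctor I κ).obj j ⋙ functor I.homFamily)
      ((succStruct I κ).iterationFunctorObjSuccIso j hj).symm κ
  | isSuccLimit j hj hj' =>
    exact isCardinalAccessible_of_isColimit κ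
      (Functor.isColimitOfIsWellOrderContinuous
        ((succStruct I κ).iterationFunctor κ.ord.ToType) j hj)
      (fun k ↦ hj' _ k.2)

lemma isCardinalAccessible_iteration [HasColimits C]
    [I.IsCardinalForSmallObjectArgument κ]
    (hI : ∀ {A B : C} (i : A ⟶ B), I i → IsCardinalPresentable (Arrow.mk i) κ) :
    (iteration I κ).IsCardinalAccessible κ := by
  exact isCardinalAccessible_of_isColimit κ
    (transfiniteCompositionOfShapeSuccStructPropιIteration I κ).isColimit
    (isCardinalAccessible_iterationFunctor_obj κ I hI)

/-- The functor sending an arrow to the first map of its functorial factorization. -/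
noncomputable def cofReplacement [I.IsCardinalForSmallObjectArgument κ] : Arrow C ⥤ Arrow C where
  obj g := Arrow.mk (ιObj I κ g.hom)
  map {g g'} φ := Arrow.homMk (f := Arrow.mk (ιObj I κ g.hom)) (g := Arrow.mk (ιObj I κ g'.hom))
    φ.left (objMap I κ φ) (ιObj_naturality I κ φ).symm
  map_id _ := Arrow.hom_ext _ _ rfl (objMap_id I κ _)
  map_comp _ _ := Arrow.hom_ext _ _ rfl (objMap_comp I κ _ _)

/-- The projection from `cofReplacement` to the identity. -/
noncomputable def cofReplacementCounit [I.IsCardinalForSmallObjectArgument κ] :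
    cofReplacement κ I ⟶ 𝟭 (Arrow C) where
  app g := Arrow.homMk (f := Arrow.mk (ιObj I κ g.hom)) (𝟙 _) (πObj I κ g.hom)
    ((Category.id_comp _).trans (ιObj_πObj I κ g.hom).symm)
  naturality _ _ φ := Arrow.hom_ext _ _
    ((Category.comp_id _).trans (Category.id_comp _).symm) (πObj_naturality I κ φ)

lemma isCardinalAccessible_cofReplacement [HasColimits C]
    [I.IsCardinalForSmallObjectArgument κ]
    (hI : ∀ {A B : C} (i : A ⟶ B), I i → IsCardinalPresentable (Arrow.mk i) κ) :
    (cofReplacement κ I).IsCardinalAccessible κ where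
  preservesColimitOfShape J _ _ := ⟨fun {F} ↦ ⟨fun {c} hc ↦ by
    have := isCardinalAccessible_iteration κ I hI
    have := (iteration I κ).preservesColimitsOfShape_of_isCardinalAccessible κ J
    have h₁ : IsColimit (Arrow.leftFunc.mapCocone c) := isColimitOfPreserves _ hc
    have h₂ : IsColimit ((iteration I κ ⋙ Arrow.leftFunc).mapCocone c) :=
      isColimitOfPreserves _ hc
    exact ⟨isColimitArrow h₁ h₂⟩⟩⟩

lemma exists_section_cofReplacementCounit [I.IsCardinalForSmallObjectArgument κ] (g : Arrow C)
    (hg : I.rlp.llp g.hom) :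
    ∃ σ : g ⟶ (cofReplacement κ I).obj g, σ ≫ (cofReplacementCounit κ I).app g = 𝟙 g := by
  have := hg _ (rlp_πObj I κ g.hom)
  have sq : CommSq (ιObj I κ g.hom) g.hom (πObj I κ g.hom) (𝟙 _) := ⟨by simp⟩
  exact ⟨Arrow.homMk (g := Arrow.mk (ιObj I κ g.hom)) (𝟙 _) sq.lift
    ((Category.id_comp _).trans sq.fac_left.symm),
    Arrow.hom_ext _ _ (Category.id_comp _) sq.fac_right⟩

end Iteration

section Coalgebras

variable {D : Type u} [Category.{v} D] {κ : Cardinal.{v}} [Fact κ.IsRegular]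
  {L : D ⥤ D} (ε : L ⟶ 𝟭 D)

/-- The `κ`-presentable objects `A` such that `ε.app A : L.obj A ⟶ A` has a section. -/
def presentableWithSection (κ : Cardinal.{v}) [Fact κ.IsRegular] : ObjectProperty D := fun A ↦
  IsCardinalPresentable A κ ∧ ∃ τ : A ⟶ L.obj A, τ ≫ ε.app A = 𝟙 A

variable {J : Type v} [PartialOrder J] {F : J ⥤ D} {c : Cocone F} (σ : c.pt ⟶ L.obj c.pt)

/-- An approximation of a section `σ` of `ε` at an object of a diagram with colimit `c.pt`. -/
structure PartialSection where
  /-- the source index -/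
  j : J
  /-- the target index -/
  k : J
  le : j ≤ k
  /-- the approximation of `σ` -/
  s : F.obj j ⟶ L.obj (F.obj k)
  s_comp : s ≫ L.map (c.ι.app k) = c.ι.app j ≫ σ
  s_app : s ≫ ε.app (F.obj k) = F.map (homOfLE le)

variable {σ}

lemma PartialSection.exists_of_index [IsCardinalFiltered J κ] [L.IsCardinalAccessible κ]
    (hc : IsColimit c) (hF : ∀ j, IsCardinalPresentable (F.obj j) κ)
    (hσ : σ ≫ ε.app c.pt = 𝟙 _) (j : J) :
    ∃ x : PartialSection ε σ, x.j = j := by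
  have := isFiltered_of_isCardinalFiltered J κ
  have := L.preservesColimitsOfShape_of_isCardinalAccessible κ J
  obtain ⟨k, s, hs⟩ := IsCardinalPresentable.exists_hom_of_isColimit κ
    (isColimitOfPreserves L hc) (c.ι.app j ≫ σ)
  change F.obj j ⟶ L.obj (F.obj k) at s
  change s ≫ L.map (c.ι.app k) = _ at hs
  obtain ⟨l, u, v, h⟩ := IsCardinalPresentable.exists_eq_of_isColimit κ hc
    (s ≫ ε.app (F.obj k)) (𝟙 (F.obj j)) (by
      have := ε.naturality (c.ι.app k)
      dsimp at this ⊢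
      rw [Category.assoc, ← this, reassoc_of% hs]
      erw [hσ]
      simp)
  have hu := ε.naturality (F.map u)
  dsimp at hu
  exact ⟨⟨j, l, leOfHom v, s ≫ L.map (F.map u),
    by rw [Category.assoc, ← L.map_comp, c.w, hs],
    by rw [Category.assoc, hu, ← Category.assoc, h, Category.id_comp]; rfl⟩, rfl⟩

lemma PartialSection.exists_next [IsCardinalFiltered J κ] [L.IsCardinalAccessible κ]
    (hc : IsColimit c) (hF : ∀ j, IsCardinalPresentable (F.obj j) κ)
    (hσ : σ ≫ ε.app c.pt = 𝟙 _) (x : PartialSection ε σ) :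
    ∃ (y : PartialSection ε σ) (h : x.k ≤ y.j),
      x.s ≫ L.map (F.map (homOfLE (h.trans y.le))) =
        F.map (homOfLE (x.le.trans h)) ≫ y.s := by
  have := isFiltered_of_isCardinalFiltered J κ
  have := L.preservesColimitsOfShape_of_isCardinalAccessible κ J
  obtain ⟨y, hy⟩ := exists_of_index ε hc hF hσ x.k
  obtain ⟨l, u, v, h⟩ := IsCardinalPresentable.exists_eq_of_isColimit κ
    (isColimitOfPreserves L hc) (X := F.obj x.j)
    (x.s ≫ L.map (F.map (homOfLE (hy.symm.le.trans y.le))))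
    (F.map (homOfLE (x.le.trans hy.symm.le)) ≫ y.s) (by
      change (_ ≫ _) ≫ L.map (c.ι.app _) = (_ ≫ _) ≫ L.map (c.ι.app _)
      rw [Category.assoc, Category.assoc, y.s_comp, c.w_assoc, ← L.map_comp, c.w, x.s_comp])
  obtain rfl : u = v := Subsingleton.elim _ _
  change (_ ≫ _) ≫ L.map (F.map u) = (_ ≫ _) ≫ L.map (F.map u) at h
  have hu := ε.naturality (F.map u)
  dsimp at hu
  refine ⟨⟨y.j, l, y.le.trans (leOfHom u), y.s ≫ L.map (F.map u), ?_, ?_⟩, hy.symm.le, ?_⟩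
  · rw [Category.assoc, ← L.map_comp, c.w, y.s_comp]
  · rw [Category.assoc, hu, ← Category.assoc, y.s_app, ← F.map_comp]
    rfl
  · rw [Category.assoc, Category.assoc, ← L.map_comp, ← F.map_comp] at h
    exact h

/-- If `κ` is uncountable, an object `X` for which `ε.app X` has a section is approximable by
`κ`-presentable objects with the same property. -/
lemma isApproximable_presentableWithSection [HasColimitsOfShape ℕ D] (hκ : Cardinal.aleph0 < κ)
    [IsCardinalFiltered J κ] [L.IsCardinalAccessible κ]
    (hc : IsColimit c) (hF : ∀ j, IsCardinalPresentable (F.obj j) κ)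
    (hσ : σ ≫ ε.app c.pt = 𝟙 _) :
    IsApproximable κ (presentableWithSection ε κ) c.pt := by
  intro G _ g
  obtain ⟨j₀, g₀, hg₀⟩ := IsCardinalPresentable.exists_hom_of_isColimit κ hc g
  obtain ⟨x₀, hx₀⟩ := PartialSection.exists_of_index ε hc hF hσ j₀
  subst hx₀
  choose next le_next hnext using PartialSection.exists_next ε hc hF hσ
  let x (n : ℕ) : PartialSection ε σ := Nat.rec x₀ (fun _ y ↦ next y) n
  have hx (n : ℕ) : x (n + 1) = next (x n) := rfl
  have hle (n : ℕ) : (x n).k ≤ (x (n + 1)).j := le_next (x n)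
  have hmono : Monotone (fun n ↦ (x n).j) :=
    monotone_nat_of_le_succ (fun n ↦ (x n).le.trans (hle n))
  let E : ℕ ⥤ D := hmono.functor ⋙ F
  let i (n : ℕ) : F.obj (x n).j ⟶ colimit E := colimit.ι E n
  have hi (n : ℕ) : F.map (homOfLE ((x n).le.trans (hle n))) ≫ i (n + 1) = i n :=
    colimit.w E (homOfLE n.le_succ)
  let t (n : ℕ) : F.obj (x n).j ⟶ L.obj (colimit E) :=
    (x n).s ≫ L.map (F.map (homOfLE (hle n)) ≫ i (n + 1))
  have ht (n : ℕ) : F.map (homOfLE ((x n).le.trans (hle n))) ≫ t (n + 1) = t n := by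
    have h₁ : F.map (homOfLE ((x n).le.trans (hle n))) ≫ (x (n + 1)).s =
      (x n).s ≫ L.map (F.map (homOfLE ((hle n).trans (x (n + 1)).le))) := (hnext (x n)).symm
    simp only [t]
    rw [reassoc_of% h₁, ← hi (n + 1), ← L.map_comp, ← F.map_comp_assoc, ← F.map_comp_assoc]
    rfl
  let τ : colimit E ⟶ L.obj (colimit E) := colimit.desc E
    { pt := L.obj (colimit E)
      ι := NatTrans.ofSequence t (fun n ↦ (ht n).trans (Category.comp_id _).symm) }
  have hτ (n : ℕ) : i n ≫ τ = t n := colimit.ι_desc _ _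
  let p : colimit E ⟶ c.pt := colimit.desc E (c.whisker hmono.functor)
  have hp (n : ℕ) : i n ≫ p = c.ι.app (x n).j := colimit.ι_desc _ _
  refine ⟨colimit E, ⟨?_, τ, ?_⟩, g₀ ≫ i 0, p, ?_⟩
  · have (n : ℕ) : IsCardinalPresentable (E.obj n) κ := hF _
    refine isCardinalPresentable_of_isColimit' _ (colimit.isColimit E) κ ?_
    have : Countable (Arrow ℕ) := Function.Injective.countable (β := ℕ × ℕ)
      (f := fun a ↦ (a.left, a.right)) (fun a b h ↦ by
        rw [Prod.mk.injEq] at h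
        exact Arrow.ext h.1 h.2 (Subsingleton.elim _ _))
    rw [hasCardinalLT_iff_of_equiv (Equiv.ulift.{v}.symm), hasCardinalLT_iff_cardinal_mk_lt]
    exact Cardinal.mk_le_aleph0.trans_lt hκ
  · refine colimit.hom_ext (fun n ↦ ?_)
    have h := ε.naturality (F.map (homOfLE (hle n)) ≫ i (n + 1))
    dsimp only [Functor.id_obj, Functor.id_map] at h
    have : i n ≫ τ ≫ ε.app (colimit E) = i n := by
      rw [reassoc_of% hτ, Category.assoc, h, reassoc_of% (x n).s_app, ← F.map_comp_assoc]
      exact hi n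
    exact this.trans (Category.comp_id _).symm
  · rw [Category.assoc, hp]
    exact hg₀

end Coalgebras

section

variable {C : Type u} [Category.{v} C] (κ : Cardinal.{v}) [Fact κ.IsRegular]

/-- The arrows in the saturation `I.rlp.llp` whose source and target are `κ`-presentable. -/
def presentableCofibrations (I : MorphismProperty C) : ObjectProperty (Arrow C) := fun g ↦
  I.rlp.llp g.hom ∧ arrowsBetweenPresentables κ g

lemma isApproximable_of_aleph0_lt [IsCardinalLocallyPresentable C κ] (hκ : Cardinal.aleph0 < κ)
    (I : MorphismProperty C) [MorphismProperty.IsSmall.{v} I]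
    (hI : ∀ {A B : C} (i : A ⟶ B), I i → arrowsBetweenPresentables κ (Arrow.mk i))
    {g : Arrow C} (hg : I.rlp.llp g.hom) :
    IsApproximable κ (presentableCofibrations κ I) g := by
  have : Nonempty κ.ord.ToType := by
    rw [Ordinal.nonempty_toType_iff, ne_eq, Cardinal.ord_eq_zero]
    exact (Fact.out : κ.IsRegular).ne_zero
  let := WellFoundedLT.toOrderBot κ.ord.ToType
  have : I.IsCardinalForSmallObjectArgument κ :=
    isCardinalForSmallObjectArgument κ I (fun i hi ↦ (hI i hi).1)
  have := isCardinalAccessible_cofReplacement κ I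
    (fun i hi ↦ (isCardinalPresentable_arrow κ (hI i hi)))
  obtain ⟨σ, hσ⟩ := exists_section_cofReplacementCounit κ I g hg
  have hg' : IsApproximable κ (isCardinalPresentable (Arrow C) κ) g :=
    fun G hG a ↦ ⟨G, hG, 𝟙 G, a, Category.id_comp _⟩
  obtain ⟨J, _, _, ⟨p⟩⟩ := hg'.exists_colimitOfShape le_rfl
  have : HasColimitsOfSize.{0, 0} (Arrow C) := hasColimitsOfSizeShrink.{0, 0, v, v} _
  intro G hG a
  obtain ⟨A, ⟨hA, τ, hτ⟩, b, d, fac⟩ :=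
    isApproximable_presentableWithSection (c := Cocone.mk g p.ι) (σ := σ)
    (cofReplacementCounit κ I) hκ p.isColimit p.prop_diag_obj hσ hG a
  refine ⟨A, ⟨?_, (arrowsBetweenPresentables_iff κ).2 hA⟩, b, d, fac⟩
  exact MorphismProperty.of_retract (P := I.rlp.llp) { i := τ, r := _, retract := hτ }
    (SmallObject.llp_rlp_ιObj I κ A.hom)

end

section

variable {D : Type u} [Category.{v} D] {κ : Cardinal.{v}} [Fact κ.IsRegular]
  {T : ObjectProperty D}

/-- A pushout of `κ`-filtered colimits is approximable as soon as the levelwise pushouts are. -/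
lemma IsApproximable.of_isPushout [HasColimits D] {J : Type v} [SmallCategory J]
    [IsCardinalFiltered J κ] {FU FV FY : J ⥤ D} (a : FU ⟶ FY) (b : FU ⟶ FV)
    {cU : Cocone FU} {cV : Cocone FV} {cY : Cocone FY} (hU : IsColimit cU) (hV : IsColimit cV)
    (hY : IsColimit cY) {α : cU.pt ⟶ cY.pt} {β : cU.pt ⟶ cV.pt}
    (hα : ∀ j, cU.ι.app j ≫ α = a.app j ≫ cY.ι.app j)
    (hβ : ∀ j, cU.ι.app j ≫ β = b.app j ≫ cV.ι.app j)
    {Z : D} {y : cY.pt ⟶ Z} {v : cV.pt ⟶ Z} (sq : IsPushout α β y v)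
    (H : ∀ (j : J) {P : D} {p : FY.obj j ⟶ P} {q : FV.obj j ⟶ P},
      IsPushout (a.app j) (b.app j) p q → IsApproximable κ T P) :
    IsApproximable κ T Z := by
  have sq₀ := IsPushout.of_hasPushout a b
  have sq₁ := sq₀.map (colim : (J ⥤ D) ⥤ D)
  let eU := (colimit.isColimit FU).coconePointUniqueUpToIso hU
  let eV := (colimit.isColimit FV).coconePointUniqueUpToIso hV
  let eY := (colimit.isColimit FY).coconePointUniqueUpToIso hY
  have h₁ : colim.map a ≫ eY.hom = eU.hom ≫ α := colimit.hom_ext (fun j ↦ by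
    simp [eY, eU, hα])
  have h₂ : colim.map b ≫ eV.hom = eU.hom ≫ β := colimit.hom_ext (fun j ↦ by
    simp [eV, eU, hβ])
  have sq₂ : IsPushout (colim.map a) (colim.map b) (eY.hom ≫ y) (eV.hom ≫ v) :=
    sq.of_iso eU.symm eY.symm eV.symm (Iso.refl _)
      (by rw [Iso.symm_hom, Iso.symm_hom, Iso.comp_inv_eq, Category.assoc, h₁, Iso.inv_hom_id_assoc])
      (by rw [Iso.symm_hom, Iso.symm_hom, Iso.comp_inv_eq, Category.assoc, h₂, Iso.inv_hom_id_assoc])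
      (by simp) (by simp)
  have hc : IsApproximable κ T (colim.obj (pushout a b)) :=
    IsApproximable.of_isColimit (colimit.isColimit (pushout a b))
      (fun j ↦ H j (sq₀.map ((evaluation J D).obj j)))
  exact hc.of_retract (Retract.ofIso (sq₂.isoIsPushout _ _ sq₁))

end

section

variable {C : Type u} [Category.{v} C] [HasColimits C]

variable (C) in
/-- The functor sending an object `A` to the arrow `⊥_ C ⟶ A`. -/
noncomputable def arrowFromInitial : C ⥤ Arrow C where
  obj A := Arrow.mk (initial.to A)
  map f := Arrow.homMk (𝟙 _) f (initialIsInitial.hom_ext _ _)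
  map_id _ := Arrow.hom_ext _ _ rfl rfl
  map_comp _ _ := Arrow.hom_ext _ _ (Category.id_comp _).symm rfl

variable (C) in
/-- The functor `A ↦ (⊥_ C ⟶ A)` is left adjoint to the target functor. -/
noncomputable def arrowFromInitialAdjunction : arrowFromInitial C ⊣ Arrow.rightFunc :=
  Adjunction.mkOfHomEquiv
    { homEquiv A g :=
        { toFun φ := φ.right
          invFun (a : A ⟶ g.right) := Arrow.homMk (initial.to _) a (initialIsInitial.hom_ext _ _)
          left_inv _ := Arrow.hom_ext _ _ (initialIsInitial.hom_ext _ _) rfl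
          right_inv _ := rfl }
      homEquiv_naturality_left_symm _ _ :=
        Arrow.hom_ext _ _ (initialIsInitial.hom_ext _ _) rfl
      homEquiv_naturality_right _ _ := rfl }

instance : (arrowFromInitial C).IsLeftAdjoint := (arrowFromInitialAdjunction C).isLeftAdjoint

lemma arrowFromInitial_hom_ext {A : C} {g : Arrow C} {φ ψ : (arrowFromInitial C).obj A ⟶ g}
    (h : φ.right = ψ.right) : φ = ψ :=
  Arrow.hom_ext _ _ (initialIsInitial.hom_ext _ _) h

/-- The morphism from `⊥_ C ⟶ A` to an arrow `g` given by `A ⟶ g.right`. -/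
noncomputable def arrowFromInitialDesc {A : C} {g : Arrow C} (a : A ⟶ g.right) :
    (arrowFromInitial C).obj A ⟶ g :=
  Arrow.homMk (initial.to _) a (initialIsInitial.hom_ext _ _)

/-- Attaching a cell to the target of an arrow is a pushout in the category of arrows. -/
lemma isPushout_arrowFromInitial {X Z A B Z' : C} (x : X ⟶ Z) {u : A ⟶ Z} {h : A ⟶ B}
    {z : Z ⟶ Z'} {b : B ⟶ Z'} (sq : IsPushout u h z b) :
    IsPushout (arrowFromInitialDesc (g := Arrow.mk x) u) ((arrowFromInitial C).map h)
      (Arrow.homMk (𝟙 X) z (by simp) : Arrow.mk x ⟶ Arrow.mk (x ≫ z))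
      (arrowFromInitialDesc (g := Arrow.mk (x ≫ z)) b) where
  w := arrowFromInitial_hom_ext sq.w
  isColimit' := ⟨PushoutCocone.IsColimit.mk _
    (fun s ↦ Arrow.homMk s.inl.left
      (sq.desc s.inl.right s.inr.right (congr_arg Arrow.Hom.right s.condition))
      (by
        have h₁ : s.inl.left ≫ s.pt.hom = x ≫ s.inl.right := Arrow.w s.inl
        exact h₁.trans ((congr_arg (x ≫ ·) (sq.inl_desc _ _ _).symm).trans
          (Category.assoc _ _ _).symm)))
    (fun s ↦ Arrow.hom_ext _ _ (Category.id_comp _) (sq.inl_desc _ _ _))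
    (fun s ↦ arrowFromInitial_hom_ext (sq.inr_desc _ _ _))
    (fun s m h₁ h₂ ↦ Arrow.hom_ext _ _
        ((Category.id_comp _).symm.trans (congr_arg Arrow.Hom.left h₁))
        (sq.hom_ext ((congr_arg Arrow.Hom.right h₁).trans (sq.inl_desc _ _ _).symm)
          ((congr_arg Arrow.Hom.right h₂).trans (sq.inr_desc _ _ _).symm)))⟩

variable {κ : Cardinal.{v}} [Fact κ.IsRegular] {I : MorphismProperty C}

lemma presentableCofibrations_of_isPushout {g h P : Arrow C}
    (hg : presentableCofibrations κ I g) (hh : presentableCofibrations κ I h)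
    {φ : (arrowFromInitial C).obj h.left ⟶ g} {y : g ⟶ P}
    {v : (arrowFromInitial C).obj h.right ⟶ P}
    (sq : IsPushout φ ((arrowFromInitial C).map h.hom) y v) :
    presentableCofibrations κ I P := by
  have sqL := sq.map Arrow.leftFunc
  have sqR := sq.map Arrow.rightFunc
  have : IsIso y.left := by
    have : IsIso (Arrow.leftFunc.map ((arrowFromInitial C).map h.hom)) :=
      inferInstanceAs (IsIso (𝟙 (⊥_ C)))
    exact sqL.isIso_inl_of_isIso
  have hP : P.hom = inv y.left ≫ g.hom ≫ y.right := by
    rw [IsIso.eq_inv_comp]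
    exact Arrow.w y
  obtain ⟨hgW, _, _⟩ := hg
  obtain ⟨hhW, _, _⟩ := hh
  have hy : I.rlp.llp y.right := MorphismProperty.of_isPushout sqR hhW
  refine ⟨?_, (isCardinalPresentable C κ).prop_of_iso (asIso y.left) ‹_›,
    IsPushout.isCardinalPresentable κ (Y := P.right) (f := φ.right) (g := h.hom)
      (A := h.left) (B := g.right) (X := h.right) sqR⟩
  rw [hP]
  exact MorphismProperty.comp_mem _ _ _ (MorphismProperty.of_isIso _ _)
    (MorphismProperty.comp_mem _ _ _ hgW hy)

end

section

variable {C : Type u} [Category.{v} C] {κ : Cardinal.{v}} [Fact κ.IsRegular]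
  [IsCardinalLocallyPresentable C κ] {I : MorphismProperty C}

lemma presentableCofibrations_le :
    presentableCofibrations κ I ≤ isCardinalPresentable (Arrow C) κ :=
  fun _ hg ↦ (arrowsBetweenPresentables_iff κ).1 hg.2

lemma isApproximable_of_isPushout_of_prop {g h P : Arrow C}
    (hg : IsApproximable κ (presentableCofibrations κ I) g) (hh : presentableCofibrations κ I h)
    {φ : (arrowFromInitial C).obj h.left ⟶ g} {y : g ⟶ P}
    {v : (arrowFromInitial C).obj h.right ⟶ P}
    (sq : IsPushout φ ((arrowFromInitial C).map h.hom) y v) :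
    IsApproximable κ (presentableCofibrations κ I) P := by
  obtain ⟨J, _, _, ⟨p⟩⟩ := hg.exists_colimitOfShape presentableCofibrations_le
  have := hh.2.1
  have : IsCardinalPresentable ((arrowFromInitial C).obj h.left) κ :=
    isCardinalPresentable_arrow_initial κ h.left
  obtain ⟨j₀, φ₀, hφ₀⟩ := IsCardinalPresentable.exists_hom_of_isColimit κ p.isColimit φ
  have := isFiltered_of_isCardinalFiltered J κ
  have := isFiltered_of_isCardinalFiltered (Under j₀) κ
  have := IsFiltered.isConnected (Under j₀)
  refine IsApproximable.of_isPushout (J := Under j₀)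
    (FU := (Functor.const _).obj _) (FV := (Functor.const _).obj _)
    (FY := Under.forget j₀ ⋙ p.diag)
    { app k := φ₀ ≫ p.diag.map k.hom
      naturality k l f := ?_ } ((Functor.const _).map ((arrowFromInitial C).map h.hom))
    (isColimitConstCocone _ _) (isColimitConstCocone _ _)
    ((Functor.Final.isColimitWhiskerEquiv (Under.forget j₀) _).symm p.isColimit)
    (fun k ↦ ?_) (fun k ↦ ?_) sq (fun k _ _ _ sq' ↦ ?_)
  · have h₁ : p.diag.map l.hom = p.diag.map k.hom ≫ p.diag.map f.right := by
      rw [← Functor.map_comp, Under.w]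
    exact (Category.id_comp _).trans ((congr_arg (φ₀ ≫ ·) h₁).trans (Category.assoc _ _ _).symm)
  · exact (Category.id_comp _).trans (hφ₀.symm.trans
      ((congr_arg (φ₀ ≫ ·) (p.w k.hom).symm).trans (Category.assoc _ _ _).symm))
  · exact (Category.id_comp _).trans (Category.comp_id _).symm
  · exact isApproximable_of_prop
      (presentableCofibrations_of_isPushout (p.prop_diag_obj k.right) hh sq')

lemma isApproximable_of_isPushout {g h P : Arrow C}
    (hg : IsApproximable κ (presentableCofibrations κ I) g)
    (hh : IsApproximable κ (presentableCofibrations κ I) h)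
    {φ : (arrowFromInitial C).obj h.left ⟶ g} {y : g ⟶ P}
    {v : (arrowFromInitial C).obj h.right ⟶ P}
    (sq : IsPushout φ ((arrowFromInitial C).map h.hom) y v) :
    IsApproximable κ (presentableCofibrations κ I) P := by
  obtain ⟨J, _, _, ⟨p⟩⟩ := hh.exists_colimitOfShape presentableCofibrations_le
  have := isFiltered_of_isCardinalFiltered J κ
  have := IsFiltered.isConnected J
  refine IsApproximable.of_isPushout (J := J)
    (FU := p.diag ⋙ Arrow.leftFunc ⋙ arrowFromInitial C)
    (FV := p.diag ⋙ Arrow.rightFunc ⋙ arrowFromInitial C)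
    (FY := (Functor.const _).obj g)
    { app k := (arrowFromInitial C).map (Arrow.leftFunc.map (p.ι.app k)) ≫ φ
      naturality k l f := ?_ }
    (Functor.whiskerLeft p.diag (Functor.whiskerRight Arrow.leftToRight _))
    (isColimitOfPreserves (Arrow.leftFunc ⋙ arrowFromInitial C) p.isColimit)
    (isColimitOfPreserves (Arrow.rightFunc ⋙ arrowFromInitial C) p.isColimit)
    (isColimitConstCocone _ _)
    (fun k ↦ ?_) (fun k ↦ ?_) sq (fun k _ _ _ sq' ↦ ?_)
  · have h₁ : (p.diag.map f).left ≫ (p.ι.app l).left = (p.ι.app k).left :=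
      congr_arg Arrow.Hom.left (p.w f)
    exact arrowFromInitial_hom_ext ((Category.assoc _ _ _).symm.trans
      ((congr_arg (fun (t : _ ⟶ h.left) ↦ t ≫ φ.right) h₁).trans (Category.comp_id _).symm))
  · exact (Category.comp_id _).symm
  · exact arrowFromInitial_hom_ext (Arrow.w (p.ι.app k))
  · exact isApproximable_of_isPushout_of_prop hg (p.prop_diag_obj k) sq'

end

section

variable {C : Type u} [Category.{v} C]

lemma presentableCofibrations_sigma {κ : Cardinal.{v}} [Fact κ.IsRegular]
    [IsCardinalLocallyPresentable C κ] {I : MorphismProperty C}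
    {ι : Type v} [Finite ι] (f : ι → Arrow C) (hf : ∀ i, presentableCofibrations κ I (f i)) :
    presentableCofibrations κ I (∐ f) := by
  have hc := colimit.isColimit (Discrete.functor f)
  refine ⟨MorphismProperty.colimitsOfShape_le (J := Discrete ι) _
    (MorphismProperty.colimitsOfShape.mk' _ _ _ _ (isColimitOfPreserves Arrow.leftFunc hc)
      (isColimitOfPreserves Arrow.rightFunc hc) (Functor.whiskerLeft _ Arrow.leftToRight)
      (fun j ↦ (hf j.as).1) _ (fun j ↦ Arrow.w ((colimit.cocone (Discrete.functor f)).ι.app j))),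
    (arrowsBetweenPresentables_iff κ).2 ?_⟩
  have (j : Discrete ι) : IsCardinalPresentable ((Discrete.functor f).obj j) κ :=
    presentableCofibrations_le _ (hf j.as)
  exact isCardinalPresentable_of_isColimit' _ hc κ
    (.of_le (by simp only [hasCardinalLT_aleph0_iff]; infer_instance)
      (Cardinal.IsRegular.aleph0_le Fact.out))

lemma isApproximable_of_isIso {κ : Cardinal.{v}} [Fact κ.IsRegular]
    [IsCardinalLocallyPresentable C κ] {I : MorphismProperty C} (g : Arrow C) [IsIso g.hom] :
    IsApproximable κ (presentableCofibrations κ I) g := by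
  intro G hG a
  have hG' := (arrowsBetweenPresentables_iff κ).2 hG
  have hw : a.left ≫ g.hom = G.hom ≫ a.right := Arrow.w a
  refine ⟨Arrow.mk (𝟙 G.right), ⟨MorphismProperty.id_mem _ _, hG'.2, hG'.2⟩,
    Arrow.homMk G.hom (𝟙 _) rfl,
    Arrow.homMk (a.right ≫ inv g.hom) a.right (by simp), Arrow.hom_ext _ _ ?_ ?_⟩
  · change G.hom ≫ a.right ≫ inv g.hom = a.left
    rw [← Category.assoc, ← hw, Category.assoc, IsIso.hom_inv_id, Category.comp_id]
  · exact Category.id_comp _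

variable [Fact Cardinal.aleph0.{v}.IsRegular]
  [IsCardinalLocallyPresentable C Cardinal.aleph0.{v}] {I : MorphismProperty C}

open CoproductsFromFiniteFiltered in
lemma isApproximable_of_coproducts (hI : ∀ {A B : C} (i : A ⟶ B), I i →
      arrowsBetweenPresentables Cardinal.aleph0.{v} (Arrow.mk i))
    {A B : C} (h : A ⟶ B) (hh : MorphismProperty.coproducts.{v} I h) :
    IsApproximable Cardinal.aleph0.{v} (presentableCofibrations Cardinal.aleph0.{v} I)
      (Arrow.mk h) := by
  classical
  rw [MorphismProperty.coproducts_iff] at hh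
  obtain ⟨α, ⟨X₁, X₂, c₁, c₂, h₁, h₂, f, hf⟩⟩ := hh
  let F : Discrete α ⥤ Arrow C :=
    { obj j := Arrow.mk (f.app j)
      map {j k} u := Arrow.homMk (f := Arrow.mk (f.app j)) (g := Arrow.mk (f.app k))
        (X₁.map u) (X₂.map u) (f.naturality u)
      map_id _ := Arrow.hom_ext _ _ (X₁.map_id _) (X₂.map_id _)
      map_comp _ _ := Arrow.hom_ext _ _ (X₁.map_comp _ _) (X₂.map_comp _ _) }
  let c : Cocone F :=
    { pt := Arrow.mk (h₁.desc (Cocone.mk _ (f ≫ c₂.ι)))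
      ι :=
        { app j := Arrow.homMk (f := Arrow.mk (f.app j)) (c₁.ι.app j) (c₂.ι.app j) (h₁.fac _ j)
          naturality _ _ u :=
            Arrow.hom_ext _ _ (c₁.ι.naturality u) (c₂.ι.naturality u) } }
  have hc : IsColimit c := isColimitArrow h₁ h₂
  have : IsCardinalFiltered (Finset (Discrete α)) Cardinal.aleph0.{v} := by
    rw [isCardinalFiltered_aleph0_iff]
    infer_instance
  have H : IsApproximable Cardinal.aleph0.{v} (presentableCofibrations Cardinal.aleph0.{v} I)
      (colimit (liftToFinsetObj F)) :=
    IsApproximable.of_isColimit (colimit.isColimit (liftToFinsetObj F)) (fun S ↦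
      isApproximable_of_prop (presentableCofibrations_sigma (fun x : S ↦ F.obj x)
        (fun x ↦ ⟨I.le_llp_rlp _ (hf x), hI _ (hf x)⟩)))
  exact H.of_retract
    (Retract.ofIso (hc.coconePointUniqueUpToIso (liftToFinsetColimitCocone F).isColimit))

lemma isApproximable_of_transfiniteComposition (hI : ∀ {A B : C} (i : A ⟶ B), I i →
      arrowsBetweenPresentables Cardinal.aleph0.{v} (Arrow.mk i))
    {X Y : C} {f : X ⟶ Y}
    (hf : (MorphismProperty.coproducts.{v} I).pushouts.TransfiniteCompositionOfShape ℕ f) :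
    IsApproximable Cardinal.aleph0.{v} (presentableCofibrations Cardinal.aleph0.{v} I)
      (Arrow.mk f) := by
  let F : ℕ ⥤ Arrow C :=
    { obj n := Arrow.mk (hf.F.map (homOfLE n.zero_le))
      map {m n} u := Arrow.homMk (f := Arrow.mk (hf.F.map (homOfLE m.zero_le)))
        (g := Arrow.mk (hf.F.map (homOfLE n.zero_le))) (𝟙 _) (hf.F.map u)
        ((Category.id_comp _).trans (hf.F.map_comp (homOfLE m.zero_le) u))
      map_id _ := Arrow.hom_ext _ _ rfl (hf.F.map_id _)
      map_comp _ _ := Arrow.hom_ext _ _ (Category.id_comp _).symm (hf.F.map_comp _ _) }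
  let c : Cocone F :=
    { pt := Arrow.mk (hf.incl.app ⊥)
      ι :=
        { app n := Arrow.homMk (f := Arrow.mk (hf.F.map (homOfLE n.zero_le)))
            (𝟙 _) (hf.incl.app n)
            ((Category.id_comp _).trans
              (((hf.incl.naturality (homOfLE n.zero_le)).trans (Category.comp_id _)).symm))
          naturality _ _ u := Arrow.hom_ext _ _ rfl (hf.incl.naturality u) } }
  have hc : IsColimit c := isColimitArrow (isColimitConstCocone ℕ (hf.F.obj 0)) hf.isColimit
  have : IsCardinalFiltered ℕ Cardinal.aleph0.{v} := by
    rw [isCardinalFiltered_aleph0_iff]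
    infer_instance
  have H (n : ℕ) : IsApproximable Cardinal.aleph0.{v}
      (presentableCofibrations Cardinal.aleph0.{v} I) (F.obj n) := by
    induction n with
    | zero =>
      have : IsIso (F.obj 0).hom :=
        inferInstanceAs (IsIso (hf.F.map (𝟙 0)))
      exact isApproximable_of_isIso _
    | succ n hn =>
      obtain ⟨A, B, h, u, b, hh, sq⟩ := hf.map_mem n (not_isMax n)
      have H := isApproximable_of_isPushout hn (isApproximable_of_coproducts hI h hh)
        (isPushout_arrowFromInitial (hf.F.map (homOfLE n.zero_le)) sq)
      have e : hf.F.map (homOfLE n.zero_le) ≫ hf.F.map (homOfLE (Order.le_succ n)) =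
        hf.F.map (homOfLE (n + 1).zero_le) := (hf.F.map_comp _ _).symm
      exact (congr_arg (fun t ↦ IsApproximable _ _ (Arrow.mk t)) e).mp H
  refine (IsApproximable.of_isColimit hc H).of_retract (Retract.ofIso
    (Arrow.isoMk hf.isoBot.symm (Iso.refl _) ?_))
  exact hf.fac.trans (Category.comp_id _).symm

lemma isApproximable_aleph0 (I : MorphismProperty C) [MorphismProperty.IsSmall.{v} I]
    (hI : ∀ {A B : C} (i : A ⟶ B), I i →
      arrowsBetweenPresentables Cardinal.aleph0.{v} (Arrow.mk i))
    {g : Arrow C} (hg : I.rlp.llp g.hom) :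
    IsApproximable Cardinal.aleph0.{v} (presentableCofibrations Cardinal.aleph0.{v} I) g := by
  let := Cardinal.orderBotAleph0OrdToType.{v}
  have : I.IsCardinalForSmallObjectArgument Cardinal.aleph0.{v} :=
    isCardinalForSmallObjectArgument _ I (fun i hi ↦ (hI i hi).1)
  rw [SmallObject.llp_rlp_of_isCardinalForSmallObjectArgument_aleph0] at hg
  obtain ⟨X, Y, f, r, ⟨hf⟩⟩ := hg
  exact (isApproximable_of_transfiniteComposition hI hf).of_retract r

end

end CombinatorialCategory

namespace PaperAcc

lemma isCardinalFiltered_iff {J : Type v} [SmallCategory J] {κ : Cardinal.{v}}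
    [Fact κ.IsRegular] :
    IsCardinalFiltered J κ ↔ CategoryTheory.IsCardinalFiltered J κ :=
  ⟨fun h ↦ ⟨fun F hA ↦ h _ ((hasCardinalLT_iff_cardinal_mk_lt _ _).1 hA) F⟩,
    fun h A _ hA F ↦ h.nonempty_cocone F ((hasCardinalLT_iff_cardinal_mk_lt _ _).2 hA)⟩

lemma isPresentable_iff {M : Type u} [Category.{v} M] {κ : Cardinal.{v}} [Fact κ.IsRegular]
    {X : M} : IsPresentable κ X ↔ IsCardinalPresentable X κ :=
  ⟨fun h ↦ ⟨fun J _ _ ↦ (h J (isCardinalFiltered_iff.2 inferInstance)).some⟩,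
    fun h J _ hJ ↦ by
      have := isCardinalFiltered_iff.1 hJ
      exact ⟨preservesColimitsOfShape_of_isCardinalPresentable X κ J⟩⟩

lemma IsLocallyPresentable.isCardinalLocallyPresentable {M : Type u} [Category.{v} M]
    {κ : Cardinal.{v}} [Fact κ.IsRegular] (h : IsLocallyPresentable M κ) :
    IsCardinalLocallyPresentable M κ := by
  obtain ⟨_, ι, G, hG, hX⟩ := h
  have : HasCardinalFilteredGenerator M κ :=
    { exists_generator := ⟨ObjectProperty.ofObj G, inferInstance,
        { le_isCardinalPresentable := by
            rintro _ ⟨i⟩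
            exact isPresentable_iff.1 (hG i)
          exists_colimitsOfShape X := by
            obtain ⟨p⟩ := hX X
            let := p.instJ
            have (j : p.J) : ObjectProperty.ofObj G (p.F.obj j) := by
              obtain ⟨i, hi⟩ := p.mem j
              rw [← hi]
              exact ⟨i⟩
            exact ⟨p.J, p.instJ, isCardinalFiltered_iff.1 p.filtered,
              ⟨{ diag := p.F
                 ι := (p.c.extend p.iso.hom).ι
                 isColimit := IsColimit.extendIso p.iso.hom p.isColimit
                 prop_diag_obj := this }⟩⟩ }⟩ }
  constructor

lemma llp_rlpOf {M : Type u} [Category.{v} M] {ι : Type w} {A B : ι → M}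
    (f : ∀ i, A i ⟶ B i) : Llp (RlpOf f) = (MorphismProperty.ofHoms f).rlp.llp := by
  have : RlpOf f = (MorphismProperty.ofHoms f).rlp := by
    ext X Y p
    exact ⟨fun h _ _ _ ⟨i⟩ ↦ h i, fun h i ↦ h _ ⟨i⟩⟩
  rw [this]
  rfl

/-- A colimit indexed by a `κ`-filtered partially ordered set is `κ`-directed. -/
def DirectedColimitPresentation.ofColimitOfShape {M : Type u} [Category.{v} M]
    {κ : Cardinal.{v}} [Fact κ.IsRegular] {P : ObjectProperty M} {Q : Set M} {X : M}
    {J : Type v} [PartialOrder J] [CategoryTheory.IsCardinalFiltered J κ]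
    (p : P.ColimitOfShape J X) (h : ∀ Y, P Y → Y ∈ Q) :
    DirectedColimitPresentation κ Q X where
  J := J
  directed S hS := ⟨IsCardinalFiltered.max (fun s : S ↦ s.1)
      ((hasCardinalLT_iff_cardinal_mk_lt _ _).2 hS),
    fun s hs ↦ leOfHom (IsCardinalFiltered.toMax (fun s : S ↦ s.1)
      ((hasCardinalLT_iff_cardinal_mk_lt _ _).2 hS) ⟨s, hs⟩)⟩
  F := p.diag
  mem j := h _ (p.prop_diag_obj j)
  c := Cocone.mk X p.ι
  isColimit := p.isColimit
  iso := Iso.refl _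

/-- Theorem 3.2. Let `K` be a `κ`-combinatorial category (a locally
`κ`-presentable category whose class of cofibrations is cofibrantly generated by a set of
morphisms between `κ`-presentable objects). Then every cofibration is a `κ`-directed colimit,
taken in the arrow category `K^→`, of cofibrations between `κ`-presentable objects. -/
theorem statement1 {K : Type u} [Category.{v} K] (κ : Cardinal.{v}) (hκ : κ.IsRegular)
    (Cof : MorphismProperty K)
    (hlp : IsLocallyPresentable K κ)
    (hgen : CofibrantlyGeneratedByPresentables κ Cof)
    {X Y : K} (f : X ⟶ Y) (hf : Cof f) :
    Nonempty (DirectedColimitPresentation (M := Arrow K) κ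
      (PresentableArrowsIn κ {a : Arrow K | Cof a.hom}) (Arrow.mk f)) := by
  have : Fact κ.IsRegular := ⟨hκ⟩
  have := hlp.isCardinalLocallyPresentable
  obtain ⟨ι, A, B, i, hA, hB, rfl⟩ := hgen
  rw [llp_rlpOf] at hf ⊢
  let I := MorphismProperty.ofHoms i
  have hI {S T : K} (j : S ⟶ T) (hj : I j) :
      CombinatorialCategory.arrowsBetweenPresentables κ (Arrow.mk j) := by
    obtain ⟨k⟩ := hj
    exact ⟨isPresentable_iff.1 (hA k), isPresentable_iff.1 (hB k)⟩
  have H : CombinatorialCategory.IsApproximable κ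
      (CombinatorialCategory.presentableCofibrations κ I) (Arrow.mk f) := by
    obtain hκ' | rfl := hκ.aleph0_le.lt_or_eq
    · exact CombinatorialCategory.isApproximable_of_aleph0_lt κ hκ' I hI hf
    · exact CombinatorialCategory.isApproximable_aleph0 I hI hf
  obtain ⟨J, _, _, ⟨p⟩⟩ :=
    H.exists_colimitOfShape CombinatorialCategory.presentableCofibrations_le
  exact ⟨.ofColimitOfShape p
    (fun g hg ↦ ⟨hg.1, isPresentable_iff.2 hg.2.1, isPresentable_iff.2 hg.2.2⟩)⟩

end PaperAcc
end
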